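/- Let $M$ be a smooth Hausdorff manifold without boundary of dimension $2n+1$, with a smooth Riemannian metric $g$, Levi-Civita connection $\nabla$, curvature tensor $R(X,Y)Z=\nabla_X\nabla_YZ-\nabla_Y\nabla_XZ-\nabla_{[X,Y]}Z$ and Ricci tensor $S(Y,Z)=\operatorname{tr}(W\mapsto R(W,Y)Z)$. Let $\varphi$ be a smooth $(1,1)$-tensor field, $\xi$ a smooth vector field and $\eta$ a $1$-form on $M$ such that $$\varphi^2=-I+\eta\otimes\xi,\qquad \eta(\xi)=1,\qquad \eta(X)=g(X,\xi),\qquad g(\varphi X,\varphi Y)=g(X,Y)-\eta(X)\eta(Y),$$ and suppose that $(M,g,\varphi,\xi,\eta)$ is a Kenmotsu manifold, i.e. $(\nabla_X\varphi)Y=g(\varphi X,Y)\xi-\eta(Y)\varphi X$ for all smooth vector fields $X,Y$. Suppose that $M$ admits a conformal $\eta$-Ricci soliton $(g,V,\lambda,\mu)$ with conformal pressure $p$, i.e. that $V$ is a smooth vector field and $\lambda,\mu,p$ are real constants with $$\mathcal L_Vg+2S+\Big[2\lambda-\Big(p+\frac{2}{2n+1}\Big)\Big]g+2\mu\,\eta\otimes\eta=0,$$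 where $\mathcal L_V$ is the Lie derivative along $V$. Then $(\mathcal L_VR)(X,\xi)\xi=0$ for every smooth vector field $X$. -/

import Mathlib

open Bundle VectorField
open scoped Manifold ContDiff

noncomputable section

namespace RiemannianGeometry

variable {E : Type*} [NormedAddCommGroup E] [NormedSpace ℝ E]
  {H : Type*} [TopologicalSpace H] {I : ModelWithCorners ℝ E H}
  {M : Type*} [TopologicalSpace M] [ChartedSpace H M] [IsManifold I ∞ M]

/-- A smooth Riemannian metric on the manifold `M`. -/
abbrev SmoothMetric {E : Type*} [NormedAddCommGroup E] [NormedSpace ℝ E]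
    {H : Type*} [TopologicalSpace H] (I : ModelWithCorners ℝ E H)
    (M : Type*) [TopologicalSpace M] [ChartedSpace H M] [IsManifold I ∞ M] :=
  ContMDiffRiemannianMetric I ∞ E (fun x : M ↦ TangentSpace I x)

/-- The right-hand side of the Koszul formula:
`X g(Y,Z) + Y g(Z,X) - Z g(X,Y) - g(X,[Y,Z]) + g(Y,[Z,X]) + g(Z,[X,Y])`. -/
def koszul (g : SmoothMetric I M)
    (X Y Z : Π x : M, TangentSpace I x) (x : M) : ℝ :=
  mvfderiv I (fun y ↦ g.inner y (Y y) (Z y)) x (X x)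
    + mvfderiv I (fun y ↦ g.inner y (Z y) (X y)) x (Y x)
    - mvfderiv I (fun y ↦ g.inner y (X y) (Y y)) x (Z x)
    - g.inner x (X x) (mlieBracket I Y Z x)
    + g.inner x (Y x) (mlieBracket I Z X x)
    + g.inner x (Z x) (mlieBracket I X Y x)

theorem mdiffAt_inner (g : SmoothMetric I M)
    {X Y : Π x : M, TangentSpace I x} {x : M}
    (hX : MDiffAt (T% X) x) (hY : MDiffAt (T% Y) x) :
    MDiffAt (fun y ↦ g.inner y (X y) (Y y)) x := by
  have h : MDifferentiableAt I (I.prod 𝓘(ℝ))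
      (fun y ↦ TotalSpace.mk' ℝ (E := Bundle.Trivial M ℝ) y (g.inner y (X y) (Y y))) x :=
    MDifferentiableAt.clm_bundle_apply₂ (b := fun y : M ↦ y) (F₁ := E) (F₂ := E)
      (g.contMDiff.mdifferentiableAt (by simp)) hX hY
  simp only [mdifferentiableAt_totalSpace] at h
  exact h.2

variable [FiniteDimensional ℝ E]

theorem koszul_tensorial_left (g : SmoothMetric I M)
    {Y Z : Π x : M, TangentSpace I x} {x : M}
    (hY : MDiffAt (T% Y) x) (hZ : MDiffAt (T% Z) x) :
    TensorialAt I E (fun X ↦ koszul g X Y Z x) x where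
  smul {f X} hf hX := by
    have h1 : (fun y ↦ g.inner y (Z y) ((f • X) y)) = fun y ↦ f y * g.inner y (Z y) (X y) := by
      ext y; simp
    have h2 : (fun y ↦ g.inner y ((f • X) y) (Y y)) = fun y ↦ f y * g.inner y (X y) (Y y) := by
      ext y; simp
    simp only [koszul, h1, h2, mvfderiv_fun_mul hf (mdiffAt_inner g hZ hX),
      mvfderiv_fun_mul hf (mdiffAt_inner g hX hY), mlieBracket_smul_left hf hX,
      mlieBracket_smul_right hf hX]
    simp [g.symm x (Y x) (X x), g.symm x (Z x) (X x)]
    ring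
  add {X X'} hX hX' := by
    have h1 : (fun y ↦ g.inner y (Z y) ((X + X') y))
        = fun y ↦ g.inner y (Z y) (X y) + g.inner y (Z y) (X' y) := by
      ext y; simp
    have h2 : (fun y ↦ g.inner y ((X + X') y) (Y y))
        = fun y ↦ g.inner y (X y) (Y y) + g.inner y (X' y) (Y y) := by
      ext y; simp
    simp only [koszul, h1, h2, mvfderiv_fun_add (mdiffAt_inner g hZ hX) (mdiffAt_inner g hZ hX'),
      mvfderiv_fun_add (mdiffAt_inner g hX hY) (mdiffAt_inner g hX' hY),
      mlieBracket_add_left hX hX', mlieBracket_add_right hX hX']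
    simp
    ring

theorem koszul_tensorial_right
    (g : SmoothMetric I M)
    {X Y : Π x : M, TangentSpace I x} {x : M}
    (hX : MDiffAt (T% X) x) (hY : MDiffAt (T% Y) x) :
    TensorialAt I E (fun Z ↦ koszul g X Y Z x) x where
  smul {f Z} hf hZ := by
    have h1 : (fun y ↦ g.inner y (Y y) ((f • Z) y)) = fun y ↦ f y * g.inner y (Y y) (Z y) := by
      ext y; simp
    have h2 : (fun y ↦ g.inner y ((f • Z) y) (X y)) = fun y ↦ f y * g.inner y (Z y) (X y) := by
      ext y; simp
    simp only [koszul, h1, h2, mvfderiv_fun_mul hf (mdiffAt_inner g hY hZ),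
      mvfderiv_fun_mul hf (mdiffAt_inner g hZ hX), mlieBracket_smul_left hf hZ,
      mlieBracket_smul_right hf hZ]
    simp [g.symm x (Y x) (Z x), g.symm x (X x) (Z x)]
    ring
  add {Z Z'} hZ hZ' := by
    have h1 : (fun y ↦ g.inner y (Y y) ((Z + Z') y))
        = fun y ↦ g.inner y (Y y) (Z y) + g.inner y (Y y) (Z' y) := by
      ext y; simp
    have h2 : (fun y ↦ g.inner y ((Z + Z') y) (X y))
        = fun y ↦ g.inner y (Z y) (X y) + g.inner y (Z' y) (X y) := by
      ext y; simp
    simp only [koszul, h1, h2, mvfderiv_fun_add (mdiffAt_inner g hY hZ) (mdiffAt_inner g hY hZ'),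
      mvfderiv_fun_add (mdiffAt_inner g hZ hX) (mdiffAt_inner g hZ' hX),
      mlieBracket_add_left hZ hZ', mlieBracket_add_right hZ hZ']
    simp
    ring

theorem koszul_add_middle
    (g : SmoothMetric I M)
    {X Y Y' Z : Π x : M, TangentSpace I x} {x : M} (hX : MDiffAt (T% X) x)
    (hY : MDiffAt (T% Y) x) (hY' : MDiffAt (T% Y') x) (hZ : MDiffAt (T% Z) x) :
    koszul g X (Y + Y') Z x = koszul g X Y Z x + koszul g X Y' Z x := by
  have h1 : (fun y ↦ g.inner y ((Y + Y') y) (Z y))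
      = fun y ↦ g.inner y (Y y) (Z y) + g.inner y (Y' y) (Z y) := by
    ext y; simp
  have h2 : (fun y ↦ g.inner y (X y) ((Y + Y') y))
      = fun y ↦ g.inner y (X y) (Y y) + g.inner y (X y) (Y' y) := by
    ext y; simp
  simp only [koszul, h1, h2, mvfderiv_fun_add (mdiffAt_inner g hY hZ) (mdiffAt_inner g hY' hZ),
    mvfderiv_fun_add (mdiffAt_inner g hX hY) (mdiffAt_inner g hX hY'),
    mlieBracket_add_left hY hY', mlieBracket_add_right hY hY']
  simp
  ring

theorem koszul_smul_middle
    (g : SmoothMetric I M)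
    {X Y Z : Π x : M, TangentSpace I x} {f : M → ℝ} {x : M} (hX : MDiffAt (T% X) x)
    (hf : MDiffAt f x) (hY : MDiffAt (T% Y) x) (hZ : MDiffAt (T% Z) x) :
    koszul g X (f • Y) Z x =
      f x * koszul g X Y Z x + 2 * (mvfderiv I f x (X x) * g.inner x (Y x) (Z x)) := by
  have h1 : (fun y ↦ g.inner y ((f • Y) y) (Z y)) = fun y ↦ f y * g.inner y (Y y) (Z y) := by
    ext y; simp
  have h2 : (fun y ↦ g.inner y (X y) ((f • Y) y)) = fun y ↦ f y * g.inner y (X y) (Y y) := by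
    ext y; simp
  simp only [koszul, h1, h2, mvfderiv_fun_mul hf (mdiffAt_inner g hY hZ),
    mvfderiv_fun_mul hf (mdiffAt_inner g hX hY), mlieBracket_smul_left hf hY,
    mlieBracket_smul_right hf hY]
  simp [g.symm x (Z x) (Y x), g.symm x (X x) (Y x)]
  ring

/-- The musical isomorphism `v ↦ g(v, ·)` from tangent vectors to covectors. -/
def flat (g : SmoothMetric I M) (x : M) :
    TangentSpace I x ≃L[ℝ] (TangentSpace I x →L[ℝ] ℝ) :=
  haveI : FiniteDimensional ℝ (TangentSpace I x) := inferInstanceAs (FiniteDimensional ℝ E)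
  haveI : T2Space (TangentSpace I x) := inferInstanceAs (T2Space E)
  (LinearEquiv.ofInjectiveOfFinrankEq (g.inner x : TangentSpace I x →ₗ[ℝ] _)
    (by
      refine (injective_iff_map_eq_zero _).2 fun v hv ↦ ?_
      by_contra hne
      have := g.pos x v hne
      simp_all)
    (by
      rw [← (LinearMap.toContinuousLinearMap (𝕜 := ℝ) (E := TangentSpace I x)
        (F' := ℝ)).finrank_eq]
      exact (Subspace.dual_finrank_eq (K := ℝ) (V := TangentSpace I x)).symm)
    ).toContinuousLinearEquiv

theorem flat_apply (g : SmoothMetric I M) (x : M)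
    (v : TangentSpace I x) : flat g x v = g.inner x v := rfl

open Classical in
/-- The Levi-Civita connection of `g`, determined by the Koszul formula
`2 g(∇_X Y, Z) = koszul g X Y Z`; here `leviCivitaFun g Y x v` is `∇_v Y` at `x`
(with the dummy value `0` where `Y` is not differentiable). -/
def leviCivitaFun (g : SmoothMetric I M)
    (Y : Π x : M, TangentSpace I x) (x : M) : TangentSpace I x →L[ℝ] TangentSpace I x :=
  if hY : MDiffAt (T% Y) x then
    ((flat g x).symm : (TangentSpace I x →L[ℝ] ℝ) →L[ℝ] TangentSpace I x) ∘L
      ((1 / 2 : ℝ) • TensorialAt.mkHom₂ (fun X Z ↦ koszul g X Y Z x) x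
        (fun _ hZ ↦ koszul_tensorial_left g hY hZ) (fun _ hX ↦ koszul_tensorial_right g hX hY))
  else 0

theorem two_mul_inner_leviCivitaFun
    (g : SmoothMetric I M)
    {X Y Z : Π x : M, TangentSpace I x} {x : M}
    (hX : MDiffAt (T% X) x) (hY : MDiffAt (T% Y) x) (hZ : MDiffAt (T% Z) x) :
    2 * g.inner x (leviCivitaFun g Y x (X x)) (Z x) = koszul g X Y Z x := by
  rw [← flat_apply]
  simp only [leviCivitaFun, hY, dite_true]
  simp only [ContinuousLinearMap.comp_apply, ContinuousLinearEquiv.coe_coe,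
    ContinuousLinearEquiv.apply_symm_apply, smul_apply]
  rw [TensorialAt.mkHom₂_apply _ _ hX hZ]
  simp

theorem eq_of_inner_eq (g : SmoothMetric I M)
    {x : M} {v w : TangentSpace I x}
    (h : ∀ Z : Π x : M, TangentSpace I x, MDiffAt (T% Z) x →
      g.inner x v (Z x) = g.inner x w (Z x)) : v = w := by
  apply (flat g x).injective
  ext u
  simpa [flat_apply] using h (FiberBundle.extend E u) (FiberBundle.mdifferentiableAt_extend ..)

theorem isCovariantDerivativeOn_leviCivitaFun (g : SmoothMetric I M) :
    IsCovariantDerivativeOn E (leviCivitaFun g) where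
  add {Y Y' x} hY hY' _ := by
    ext u
    obtain ⟨X, hX, rfl⟩ : ∃ X : Π x : M, TangentSpace I x, MDiffAt (T% X) x ∧ X x = u :=
      ⟨FiberBundle.extend E u, FiberBundle.mdifferentiableAt_extend .., by simp⟩
    refine eq_of_inner_eq g fun Z hZ ↦ ?_
    have h := two_mul_inner_leviCivitaFun g hX (mdifferentiableAt_add_section hY hY') hZ
    have h1 := two_mul_inner_leviCivitaFun g hX hY hZ
    have h2 := two_mul_inner_leviCivitaFun g hX hY' hZ
    have h3 := koszul_add_middle g hX hY hY' hZ
    simp only [add_apply, map_add]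
    change 2 * g.inner x (leviCivitaFun g (Y + Y') x (X x)) (Z x) = koszul g X (Y + Y') Z x at h
    linarith
  leibniz {Y f x} hY hf _ := by
    ext u
    obtain ⟨X, hX, rfl⟩ : ∃ X : Π x : M, TangentSpace I x, MDiffAt (T% X) x ∧ X x = u :=
      ⟨FiberBundle.extend E u, FiberBundle.mdifferentiableAt_extend .., by simp⟩
    refine eq_of_inner_eq g fun Z hZ ↦ ?_
    have h := two_mul_inner_leviCivitaFun g hX (hf.smul_section hY) hZ
    have h1 := two_mul_inner_leviCivitaFun g hX hY hZ
    have h3 := koszul_smul_middle g hX hf hY hZ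
    change 2 * g.inner x (leviCivitaFun g (f • Y) x (X x)) (Z x) = koszul g X (f • Y) Z x at h
    simp only [add_apply, map_add, smul_apply, map_smul, ContinuousLinearMap.smulRight_apply,
      smul_eq_mul]
    rw [← h1] at h3
    linarith

/-- The Levi-Civita connection of `g`, as a covariant derivative on the tangent bundle. -/
def leviCivita (g : SmoothMetric I M) :
    CovariantDerivative I E (fun x : M ↦ TangentSpace I x) where
  toFun := leviCivitaFun g
  isCovariantDerivativeOnUniv := isCovariantDerivativeOn_leviCivitaFun g

/-- The vector field `∇_X Y`, for the Levi-Civita connection `∇` of `g`. -/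
def nabla (g : SmoothMetric I M) (X Y : Π x : M, TangentSpace I x) :
    Π x : M, TangentSpace I x :=
  fun x ↦ leviCivita g Y x (X x)

/-- The Koszul formula. -/
theorem two_mul_inner_nabla (g : SmoothMetric I M) {X Y Z : Π x : M, TangentSpace I x} {x : M}
    (hX : MDiffAt (T% X) x) (hY : MDiffAt (T% Y) x) (hZ : MDiffAt (T% Z) x) :
    2 * g.inner x (nabla g X Y x) (Z x) = koszul g X Y Z x :=
  two_mul_inner_leviCivitaFun g hX hY hZ

/-- The Levi-Civita connection is torsion-free. -/
theorem nabla_sub_nabla (g : SmoothMetric I M) {X Y : Π x : M, TangentSpace I x} {x : M}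
    (hX : MDiffAt (T% X) x) (hY : MDiffAt (T% Y) x) :
    nabla g X Y x - nabla g Y X x = mlieBracket I X Y x := by
  refine eq_of_inner_eq g fun Z hZ ↦ ?_
  have h1 := two_mul_inner_nabla g hX hY hZ
  have h2 := two_mul_inner_nabla g hY hX hZ
  have e (A B : Π x : M, TangentSpace I x) :
      (fun y ↦ g.inner y (A y) (B y)) = fun y ↦ g.inner y (B y) (A y) :=
    funext fun y ↦ g.symm y _ _
  have b1 : mlieBracket I Y X x = -mlieBracket I X Y x := mlieBracket_swap_apply
  have b2 : mlieBracket I Z Y x = -mlieBracket I Y Z x := mlieBracket_swap_apply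
  have b3 : mlieBracket I Z X x = -mlieBracket I X Z x := mlieBracket_swap_apply
  simp only [koszul, b1, b2, b3, map_neg, e X Z, e Z Y, e Y X] at h1 h2
  simp only [map_sub, sub_apply]
  rw [g.symm x (mlieBracket I X Y x)]
  linarith

/-- The Levi-Civita connection is metric: `X g(Y,Z) = g(∇_X Y, Z) + g(Y, ∇_X Z)`. -/
theorem mvfderiv_inner (g : SmoothMetric I M) {X Y Z : Π x : M, TangentSpace I x} {x : M}
    (hX : MDiffAt (T% X) x) (hY : MDiffAt (T% Y) x) (hZ : MDiffAt (T% Z) x) :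
    mvfderiv I (fun y ↦ g.inner y (Y y) (Z y)) x (X x) =
      g.inner x (nabla g X Y x) (Z x) + g.inner x (Y x) (nabla g X Z x) := by
  have h1 := two_mul_inner_nabla g hX hY hZ
  have h2 := two_mul_inner_nabla g hX hZ hY
  have e (A B : Π x : M, TangentSpace I x) :
      (fun y ↦ g.inner y (A y) (B y)) = fun y ↦ g.inner y (B y) (A y) :=
    funext fun y ↦ g.symm y _ _
  have b1 : mlieBracket I Y X x = -mlieBracket I X Y x := mlieBracket_swap_apply
  have b2 : mlieBracket I Z Y x = -mlieBracket I Y Z x := mlieBracket_swap_apply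
  have b3 : mlieBracket I Z X x = -mlieBracket I X Z x := mlieBracket_swap_apply
  simp only [koszul, b1, b2, b3, map_neg, e X Z, e Z Y, e Y X] at h1 h2
  rw [g.symm x (Y x)]
  linarith

/-- The vector field `X` is smooth. -/
def IsSmoothVF (X : Π x : M, TangentSpace I x) : Prop :=
  ContMDiff I (I.prod 𝓘(ℝ, E)) ∞
    (fun x ↦ TotalSpace.mk' E (E := fun x : M ↦ TangentSpace I x) x (X x))

/-- The curvature `R(X,Y)Z = ∇_X ∇_Y Z - ∇_Y ∇_X Z - ∇_[X,Y] Z`. -/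
def curvature (g : SmoothMetric I M) (X Y Z : Π x : M, TangentSpace I x) :
    Π x : M, TangentSpace I x :=
  nabla g X (nabla g Y Z) - nabla g Y (nabla g X Z) - nabla g (mlieBracket I X Y) Z

/-- The Ricci tensor `S(Y,Z) = trace (W ↦ R(W,Y)Z)`.  The trace at `x` is computed in a basis
of the tangent space at `x`, whose members are extended to vector fields smooth near `x`. -/
def ricci (g : SmoothMetric I M) (Y Z : Π x : M, TangentSpace I x) (x : M) : ℝ :=
  let b : Module.Basis (Fin (Module.finrank ℝ E)) ℝ (TangentSpace I x) := Module.finBasis ℝ E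
  ∑ i, b.repr (curvature g (FiberBundle.extend E (b i)) Y Z x) i

/-- The Lie derivative `(L_V g)(X,Y) = V g(X,Y) - g([V,X],Y) - g(X,[V,Y])` of the metric. -/
def lieMetric (g : SmoothMetric I M) (V X Y : Π x : M, TangentSpace I x) (x : M) : ℝ :=
  mvfderiv I (fun y ↦ g.inner y (X y) (Y y)) x (V x)
    - g.inner x (mlieBracket I V X x) (Y x) - g.inner x (X x) (mlieBracket I V Y x)

/-- The Lie derivative of the curvature tensor,
`(L_V R)(X,Y)Z = [V, R(X,Y)Z] - R([V,X],Y)Z - R(X,[V,Y])Z - R(X,Y)[V,Z]`. -/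
def lieCurvature (g : SmoothMetric I M) (V X Y Z : Π x : M, TangentSpace I x) :
    Π x : M, TangentSpace I x :=
  mlieBracket I V (curvature g X Y Z) - curvature g (mlieBracket I V X) Y Z
    - curvature g X (mlieBracket I V Y) Z - curvature g X Y (mlieBracket I V Z)

/-- An almost contact structure `(φ, ξ, η)` compatible with the Riemannian metric `g`.
Smoothness of `η` need not be required: it follows from `η = g(·, ξ)`. -/
structure AlmostContactMetricStructure (g : SmoothMetric I M) where
  φ : Π x : M, TangentSpace I x →L[ℝ] TangentSpace I x
  ξ : Π x : M, TangentSpace I x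
  η : Π x : M, TangentSpace I x →L[ℝ] ℝ
  contMDiff_φ : ContMDiff I (I.prod 𝓘(ℝ, E →L[ℝ] E)) ∞
    (fun x ↦ TotalSpace.mk' (E →L[ℝ] E)
      (E := fun x : M ↦ TangentSpace I x →L[ℝ] TangentSpace I x) x (φ x))
  contMDiff_ξ : IsSmoothVF ξ
  φ_φ : ∀ (x : M) (v : TangentSpace I x), φ x (φ x v) = -v + η x v • ξ x
  η_ξ : ∀ x : M, η x (ξ x) = 1
  η_eq : ∀ (x : M) (v : TangentSpace I x), η x v = g.inner x v (ξ x)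
  inner_φ_φ : ∀ (x : M) (v w : TangentSpace I x),
    g.inner x (φ x v) (φ x w) = g.inner x v w - η x v * η x w

/-- The Kenmotsu condition `(∇_X φ)Y = g(φX, Y)ξ - η(Y)φX`, where
`(∇_X φ)Y = ∇_X (φY) - φ(∇_X Y)`. -/
def AlmostContactMetricStructure.IsKenmotsu {g : SmoothMetric I M}
    (A : AlmostContactMetricStructure g) : Prop :=
  ∀ X Y : Π x : M, TangentSpace I x, IsSmoothVF X → IsSmoothVF Y → ∀ x : M,
    nabla g X (fun y ↦ A.φ y (Y y)) x - A.φ x (nabla g X Y x) =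
      g.inner x (A.φ x (X x)) (Y x) • A.ξ x - A.η x (Y x) • A.φ x (X x)

/-- `(g, V, lam, mu)` is a conformal η-Ricci soliton with conformal pressure `p`:
`V` is a smooth vector field with
`L_V g + 2S + [2 lam - (p + 2 / dim M)] g + 2 mu η ⊗ η = 0`. -/
structure AlmostContactMetricStructure.IsConformalEtaRicciSoliton {g : SmoothMetric I M}
    (A : AlmostContactMetricStructure g) (V : Π x : M, TangentSpace I x) (lam mu p : ℝ) :
    Prop where
  smooth : IsSmoothVF V
  eq_zero : ∀ X Y : Π x : M, TangentSpace I x, IsSmoothVF X → IsSmoothVF Y → ∀ x : M,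
    lieMetric g V X Y x + 2 * ricci g X Y x
      + (2 * lam - (p + 2 / (Module.finrank ℝ E : ℝ))) * g.inner x (X x) (Y x)
      + 2 * mu * (A.η x (X x) * A.η x (Y x)) = 0

end RiemannianGeometry

end

/-- A Lie–Rinehart algebra `L` over `A` with a metric and its Levi-Civita connection, modelled on
the vector fields on a Riemannian manifold as a module over the smooth functions.  The Lie bracket
is recovered from the connection as `∇_X Y - ∇_Y X`. -/
structure MetricLieRinehart (A L : Type*) [CommRing A] [AddCommGroup L] [Module A L] where
  act : L →+ A →+ A
  conn : L →+ L →+ L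
  metric : L →ₗ[A] L →ₗ[A] A
  act_mul : ∀ (X : L) (f h : A), act X (f * h) = act X f * h + f * act X h
  act_smul_left : ∀ (f : A) (X : L) (h : A), act (f • X) h = f * act X h
  conn_smul_left : ∀ (f : A) (X Y : L), conn (f • X) Y = f • conn X Y
  conn_smul : ∀ (X : L) (f : A) (Y : L), conn X (f • Y) = f • conn X Y + act X f • Y
  act_bracket : ∀ X Y f, act (conn X Y - conn Y X) f = act X (act Y f) - act Y (act X f)
  jacobi : ∀ X Y Z,
    conn X (conn Y Z - conn Z Y) - conn (conn Y Z - conn Z Y) X =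
      conn (conn X Y - conn Y X) Z - conn Z (conn X Y - conn Y X)
        + (conn Y (conn X Z - conn Z X) - conn (conn X Z - conn Z X) Y)
  metric_symm : ∀ X Y, metric X Y = metric Y X
  act_metric : ∀ X Y Z, act X (metric Y Z) = metric (conn X Y) Z + metric Y (conn X Z)
  ext_metric : ∀ X Y, (∀ Z, metric X Z = metric Y Z) → X = Y
  two_mul_cancel : ∀ f : A, 2 * f = 0 → f = 0

namespace MetricLieRinehart

variable {A L : Type*} [CommRing A] [AddCommGroup L] [Module A L] (K : MetricLieRinehart A L)

/-- The Lie bracket. -/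
def bracket (X Y : L) : L := K.conn X Y - K.conn Y X

/-- The curvature `R(X,Y)Z`. -/
def curv (X Y Z : L) : L :=
  K.conn X (K.conn Y Z) - K.conn Y (K.conn X Z) - K.conn (K.bracket X Y) Z

/-- The Lie derivative of a bilinear form. -/
def lieForm (X : L) (B : L → L → A) (Y Z : L) : A :=
  K.act X (B Y Z) - B (K.bracket X Y) Z - B Y (K.bracket X Z)

/-- The Lie derivative of the curvature tensor. -/
def lieCurv (V X Y Z : L) : L :=
  K.bracket V (K.curv X Y Z) - K.curv (K.bracket V X) Y Z
    - K.curv X (K.bracket V Y) Z - K.curv X Y (K.bracket V Z)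

theorem act_one (X : L) : K.act X 1 = 0 := by
  have h := K.act_mul X 1 1
  simp only [mul_one, one_mul] at h
  linear_combination -h

theorem bracket_smul (X : L) (f : A) (Y : L) :
    K.bracket X (f • Y) = f • K.bracket X Y + K.act X f • Y := by
  simp only [bracket, K.conn_smul, K.conn_smul_left]
  module

theorem bracket_smul_left (X : L) (f : A) (Y : L) :
    K.bracket (f • X) Y = f • K.bracket X Y - K.act Y f • X := by
  simp only [bracket, K.conn_smul, K.conn_smul_left]
  module

theorem bracket_sub (X Y Z : L) : K.bracket X (Y - Z) = K.bracket X Y - K.bracket X Z := by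
  simp only [bracket, map_sub, AddMonoidHom.sub_apply]
  abel

theorem bracket_swap (X Y : L) : K.bracket Y X = -K.bracket X Y := by
  simp only [bracket]
  abel

theorem bracket_sum {ι : Type*} (s : Finset ι) (X : L) (Y : ι → L) :
    K.bracket X (∑ i ∈ s, Y i) = ∑ i ∈ s, K.bracket X (Y i) := by
  simp only [bracket, map_sum, AddMonoidHom.finsetSum_apply, Finset.sum_sub_distrib]

theorem bracket_jacobi (X Y Z : L) :
    K.bracket X (K.bracket Y Z) = K.bracket (K.bracket X Y) Z + K.bracket Y (K.bracket X Z) :=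
  K.jacobi X Y Z

theorem act_bracket' (X Y : L) (f : A) :
    K.act (K.bracket X Y) f = K.act X (K.act Y f) - K.act Y (K.act X f) :=
  K.act_bracket X Y f

theorem curv_swap (X Y Z : L) : K.curv X Y Z = -K.curv Y X Z := by
  simp only [curv, bracket, map_sub, AddMonoidHom.sub_apply]
  abel

theorem curv_add_left (X X' Y Z : L) : K.curv (X + X') Y Z = K.curv X Y Z + K.curv X' Y Z := by
  simp only [curv, bracket, map_add, map_sub, AddMonoidHom.add_apply, AddMonoidHom.sub_apply]
  abel

theorem curv_smul_left (f : A) (X Y Z : L) : K.curv (f • X) Y Z = f • K.curv X Y Z := by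
  simp only [curv, bracket_smul_left, K.conn_smul, K.conn_smul_left, map_sub,
    AddMonoidHom.sub_apply]
  module

/-- The first Bianchi identity. -/
theorem curv_bianchi (X Y Z : L) : K.curv X Y Z + K.curv Y Z X + K.curv Z X Y = 0 := by
  have h := K.jacobi X Y Z
  simp only [map_sub, AddMonoidHom.sub_apply] at h
  simp only [curv, bracket, map_sub, AddMonoidHom.sub_apply]
  linear_combination (norm := module) h

theorem metric_curv_skew (X Y Z W : L) :
    K.metric (K.curv X Y Z) W = -K.metric (K.curv X Y W) Z := by
  have h := K.act_bracket' X Y (K.metric Z W)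
  simp only [K.act_metric, map_add] at h
  rw [K.metric_symm (K.curv X Y W) Z]
  simp only [curv, map_sub, LinearMap.sub_apply]
  linear_combination -h

theorem metric_curv_pair (X Y Z W : L) :
    K.metric (K.curv X Y Z) W = K.metric (K.curv Z W X) Y := by
  have b (P Q R S : L) : K.metric (K.curv P Q R) S + K.metric (K.curv Q R P) S
      + K.metric (K.curv R P Q) S = 0 := by
    have := congrArg (fun v ↦ K.metric v S) (K.curv_bianchi P Q R)
    simpa only [map_add, LinearMap.add_apply, map_zero, LinearMap.zero_apply] using this
  have s (P Q R S : L) : K.metric (K.curv P Q R) S = -K.metric (K.curv Q P R) S := by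
    rw [K.curv_swap, map_neg, LinearMap.neg_apply]
  have k := K.metric_curv_skew
  rw [← sub_eq_zero]
  apply K.two_mul_cancel
  linear_combination b X Y Z W - b W X Y Z + b Y Z W X - b Z W X Y - k Y Z X W - s Z X Y W
    + k X Z Y W + k W X Y Z + k X Y Z W - s W Y Z X + k Y W Z X - k Z W Y X

/-- The Lie derivatives of the metric along two fields commute up to the bracket. -/
theorem lieForm_lieForm_metric (X Y Z W : L) :
    K.lieForm X (K.lieForm Y fun P Q ↦ K.metric P Q) Z W
      - K.lieForm Y (K.lieForm X fun P Q ↦ K.metric P Q) Z W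
      = K.lieForm (K.bracket X Y) (fun P Q ↦ K.metric P Q) Z W := by
  have hZ := congrArg (fun v ↦ K.metric v W) (K.bracket_jacobi X Y Z)
  have hW := congrArg (K.metric Z) (K.bracket_jacobi X Y W)
  simp only [map_add, LinearMap.add_apply] at hZ hW
  simp only [lieForm, map_sub, K.act_bracket' X Y]
  linear_combination -hZ - hW

theorem act_natCast (X : L) (n : ℕ) : K.act X (n : A) = 0 := by
  induction n with
  | zero => simp
  | succ n ih => rw [Nat.cast_succ, map_add, ih, K.act_one, add_zero]

theorem act_two (X : L) : K.act X 2 = 0 := by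
  simpa using K.act_natCast X 2

/-- A field `ξ` satisfies `∇_X ξ = X - η(X) ξ` with `η = g(·, ξ)` and has unit length, as the
structure field of a Kenmotsu manifold does. -/
structure IsKenmotsuField (ξ : L) : Prop where
  metric_self : K.metric ξ ξ = 1
  conn_self : ∀ X, K.conn X ξ = X - K.metric X ξ • ξ

namespace IsKenmotsuField

variable {K} {ξ : L} (hξ : K.IsKenmotsuField ξ)
include hξ

theorem act_metric_self (X Y : L) :
    K.act X (K.metric Y ξ) =
      K.metric (K.conn X Y) ξ + K.metric Y X - K.metric X ξ * K.metric Y ξ := by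
  rw [K.act_metric, hξ.conn_self]
  simp only [map_sub, map_smul, smul_eq_mul]
  ring

theorem bracket_self (X : L) : K.bracket ξ X = K.conn ξ X - X + K.metric X ξ • ξ := by
  rw [bracket, hξ.conn_self]
  module

/-- The form `η` is closed. -/
theorem metric_bracket_self (X Y : L) :
    K.metric (K.bracket X Y) ξ = K.act X (K.metric Y ξ) - K.act Y (K.metric X ξ) := by
  rw [hξ.act_metric_self, hξ.act_metric_self, K.metric_symm X Y, bracket]
  simp only [map_sub, LinearMap.sub_apply]
  ring

theorem curv_apply_self (X Y : L) :
    K.curv X Y ξ = K.metric X ξ • Y - K.metric Y ξ • X := by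
  simp only [curv, hξ.conn_self, map_sub, K.conn_smul, hξ.metric_bracket_self]
  simp only [bracket]
  module

theorem curv_self_right (X Y : L) :
    K.curv X ξ Y = K.metric X Y • ξ - K.metric Y ξ • X := by
  refine K.ext_metric _ _ fun W ↦ ?_
  rw [K.metric_curv_pair, K.metric_curv_skew, hξ.curv_apply_self]
  simp only [map_sub, map_smul, LinearMap.sub_apply, LinearMap.smul_apply, smul_eq_mul]
  rw [K.metric_symm ξ W, K.metric_symm Y X, K.metric_symm W X, K.metric_symm W ξ]
  ring

theorem act_self_metric (Y Z : L) :
    K.act ξ (K.metric Y Z) = K.metric (K.bracket ξ Y) Z + K.metric Y (K.bracket ξ Z)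
      + 2 * (K.metric Y Z - K.metric Y ξ * K.metric Z ξ) := by
  rw [K.act_metric, hξ.bracket_self, hξ.bracket_self]
  simp only [map_sub, map_add, map_smul, LinearMap.sub_apply, LinearMap.add_apply,
    LinearMap.smul_apply, smul_eq_mul]
  rw [K.metric_symm ξ Z]
  ring

theorem metric_bracket_self_self (Y : L) :
    K.metric (K.bracket ξ Y) ξ = K.act ξ (K.metric Y ξ) := by
  rw [hξ.metric_bracket_self, hξ.metric_self, K.act_one, sub_zero]

/-- The Lie derivative of the connection along `ξ`. -/
theorem bracket_self_conn (X Y : L) :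
    K.bracket ξ (K.conn X Y) = K.conn (K.bracket ξ X) Y + K.conn X (K.bracket ξ Y)
      - (2 * (K.metric X Y - K.metric X ξ * K.metric Y ξ)) • ξ := by
  have h1 := hξ.curv_self_right X Y
  rw [K.curv_swap] at h1
  have h2 := hξ.act_metric_self X Y
  have e : K.bracket ξ (K.conn X Y) - K.conn (K.bracket ξ X) Y - K.conn X (K.bracket ξ Y)
      = K.curv ξ X Y + K.conn X (K.conn Y ξ) - K.conn (K.conn X Y) ξ := by
    simp only [curv, bracket, map_sub]
    abel
  rw [hξ.conn_self, hξ.conn_self, map_sub, K.conn_smul, hξ.conn_self, h2] at e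
  rw [K.metric_symm Y X] at e
  linear_combination (norm := module) e - h1

/-- The Lie derivative of the curvature along `ξ`. -/
theorem lieCurv_self (X Y Z : L) :
    K.lieCurv ξ X Y Z =
      (2 * (K.metric X Z - K.metric X ξ * K.metric Z ξ)) • Y
        - (2 * (K.metric Y Z - K.metric Y ξ * K.metric Z ξ)) • X := by
  have hj := congrArg (fun v ↦ K.conn v Z) (K.bracket_jacobi ξ X Y)
  simp only [map_add, AddMonoidHom.add_apply] at hj
  simp only [lieCurv, curv, K.bracket_sub, hξ.bracket_self_conn, map_sub, map_add, hj,
    K.conn_smul, hξ.conn_self]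
  simp only [K.act_mul, K.act_two, map_sub, K.act_metric, hξ.conn_self]
  simp only [bracket, map_sub, map_smul, LinearMap.sub_apply, smul_eq_mul]
  rw [K.metric_symm Y X, K.metric_symm Z X, K.metric_symm Z Y]
  module

/-- The Lie derivative of `L_ξ g = 2 (g - η ⊗ η)`. -/
theorem lieForm_lieForm_self (Z : L) : K.lieForm Z (K.lieForm ξ fun P Q ↦ K.metric P Q) =
    fun X Y ↦ 2 * (K.lieForm Z (fun P Q ↦ K.metric P Q) X Y
      - (K.act Z (K.metric X ξ) - K.metric (K.bracket Z X) ξ) * K.metric Y ξ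
      - K.metric X ξ * (K.act Z (K.metric Y ξ) - K.metric (K.bracket Z Y) ξ)) := by
  have e : (K.lieForm ξ fun P Q ↦ K.metric P Q) =
      fun X Y ↦ 2 * (K.metric X Y - K.metric X ξ * K.metric Y ξ) := by
    funext X Y
    simp only [lieForm, hξ.act_self_metric X Y]
    ring
  rw [e]
  funext X Y
  simp only [lieForm, map_sub, K.act_mul, K.act_two]
  ring

end IsKenmotsuField
/-- The soliton equation `L_V g + 2 S + c g + 2 μ η ⊗ η = 0` on a Kenmotsu structure of
dimension `m + 1`, where `S` has the Lie derivative and contraction with `ξ` that the Ricci tensor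
has. -/
structure IsEtaSoliton (ξ V : L) (S : L → L → A) (m : ℕ) (c μ : A) : Prop where
  act_c : ∀ X, K.act X c = 0
  act_μ : ∀ X, K.act X μ = 0
  apply_self : ∀ X, S X ξ = -(m * K.metric X ξ)
  lieForm_self : ∀ X Y,
    K.lieForm ξ S X Y = -(2 * m * (K.metric X Y - K.metric X ξ * K.metric Y ξ))
  soliton : ∀ X Y, K.lieForm V (fun P Q ↦ K.metric P Q) X Y + 2 * S X Y + c * K.metric X Y
    + 2 * μ * (K.metric X ξ * K.metric Y ξ) = 0

namespace IsEtaSoliton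

variable {K} {ξ V : L} {S : L → L → A} {m : ℕ} {c μ : A}

theorem act_const (h : K.IsEtaSoliton ξ V S m c μ) (X : L) : K.act X (2 * m - c - 2 * μ) = 0 := by
  simp only [map_sub, K.act_mul, K.act_two, K.act_natCast, h.act_c, h.act_μ]
  ring

variable (h : K.IsEtaSoliton ξ V S m c μ) (hξ : K.IsKenmotsuField ξ)
include h hξ

theorem lieForm_metric_self (X : L) :
    K.lieForm V (fun P Q ↦ K.metric P Q) X ξ = (2 * m - c - 2 * μ) * K.metric X ξ := by
  have h1 := h.soliton X ξ
  rw [h.apply_self, hξ.metric_self] at h1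
  linear_combination h1

/-- `2 η([V, ξ]) = -k` for the constant `k = 2 m - c - 2 μ`. -/
theorem two_mul_metric_bracket :
    2 * K.metric (K.bracket V ξ) ξ = -(2 * m - c - 2 * μ) := by
  have h1 := h.lieForm_metric_self hξ ξ
  simp only [lieForm, hξ.metric_self, K.act_one] at h1
  rw [K.metric_symm ξ (K.bracket V ξ)] at h1
  linear_combination -h1

theorem act_metric_bracket (X : L) : K.act X (K.metric (K.bracket V ξ) ξ) = 0 := by
  apply K.two_mul_cancel
  have h1 := congrArg (K.act X) (h.two_mul_metric_bracket hξ)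
  rw [map_neg, h.act_const, K.act_mul, K.act_two] at h1
  linear_combination h1

/-- The Lie derivative of `η` along `[V, ξ]` vanishes. -/
theorem act_bracket_metric (X : L) :
    K.act (K.bracket V ξ) (K.metric X ξ) = K.metric (K.bracket (K.bracket V ξ) X) ξ := by
  rw [hξ.metric_bracket_self, h.act_metric_bracket hξ, sub_zero]

theorem act_metric_self (X : L) :
    K.act V (K.metric X ξ) = K.metric (K.bracket V X) ξ + K.metric X (K.bracket V ξ)
      + (2 * m - c - 2 * μ) * K.metric X ξ := by
  have h1 := h.lieForm_metric_self hξ X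
  simp only [lieForm] at h1
  linear_combination h1

theorem lieForm_self_lieForm (X Y : L) :
    K.lieForm ξ (K.lieForm V fun P Q ↦ K.metric P Q) X Y =
      2 * (2 * m - c) * (K.metric X Y - K.metric X ξ * K.metric Y ξ) := by
  have e : (K.lieForm V fun P Q ↦ K.metric P Q) = fun X Y ↦ -(2 * S X Y) - c * K.metric X Y
      - 2 * μ * (K.metric X ξ * K.metric Y ξ) := by
    funext X Y
    linear_combination h.soliton X Y
  have h1 := h.lieForm_self X Y
  rw [e]
  simp only [lieForm, map_sub, map_neg, K.act_mul, K.act_two, h.act_c, h.act_μ] at h1 ⊢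
  simp only [hξ.act_self_metric X Y, ← hξ.metric_bracket_self_self]
  linear_combination -2 * h1

theorem lieForm_bracket_metric :
    (K.lieForm (K.bracket V ξ) fun P Q ↦ K.metric P Q) = fun X Y ↦
      2 * K.lieForm V (fun P Q ↦ K.metric P Q) X Y
      - 4 * (2 * m - c - 2 * μ) * (K.metric X ξ * K.metric Y ξ)
      - 2 * (K.metric X (K.bracket V ξ) * K.metric Y ξ
        + K.metric X ξ * K.metric Y (K.bracket V ξ))
      - 2 * (2 * m - c) * (K.metric X Y - K.metric X ξ * K.metric Y ξ) := by
  funext X Y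
  have h1 := K.lieForm_lieForm_metric V ξ X Y
  rw [h.lieForm_self_lieForm hξ, hξ.lieForm_lieForm_self V] at h1
  simp only [h.act_metric_self hξ] at h1
  linear_combination -h1

/-- `[ξ, U] = -2 U - k ξ` for `U = [V, ξ]`. -/
theorem bracket_self_bracket :
    K.bracket ξ (K.bracket V ξ) =
      (-2 : A) • K.bracket V ξ - (2 * m - c - 2 * μ) • ξ := by
  refine K.ext_metric _ _ fun X ↦ ?_
  have h1 := congrFun (congrFun (h.lieForm_bracket_metric hξ) X) ξ
  rw [h.lieForm_metric_self hξ] at h1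
  simp only [lieForm, h.act_bracket_metric hξ, hξ.metric_self] at h1
  rw [K.bracket_swap ξ (K.bracket V ξ), map_neg] at h1
  simp only [map_sub, map_smul, LinearMap.sub_apply, LinearMap.smul_apply, smul_eq_mul]
  rw [K.metric_symm _ X, K.metric_symm _ X, K.metric_symm ξ X]
  rw [K.metric_symm ξ (K.bracket V ξ)] at h1
  linear_combination h1 - K.metric X ξ * h.two_mul_metric_bracket hξ

theorem act_self_metric_bracket (X : L) :
    K.act ξ (K.metric X (K.bracket V ξ)) = K.metric (K.bracket ξ X) (K.bracket V ξ) := by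
  rw [hξ.act_self_metric, h.bracket_self_bracket hξ]
  simp only [map_sub, map_smul, smul_eq_mul]
  linear_combination -K.metric X ξ * h.two_mul_metric_bracket hξ

theorem lieForm_self_lieForm_bracket (X Y : L) :
    K.lieForm ξ (K.lieForm (K.bracket V ξ) fun P Q ↦ K.metric P Q) X Y = 0 := by
  have h1 := h.lieForm_self_lieForm hξ X Y
  have a4 : K.act ξ 4 = 0 := by simpa using K.act_natCast ξ 4
  have ak := h.act_const ξ
  have aK : K.act ξ (2 * m - c) = 0 := by
    simp only [map_sub, K.act_mul, K.act_two, K.act_natCast, h.act_c]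
    ring
  rw [h.lieForm_bracket_metric hξ]
  rw [lieForm] at h1 ⊢
  simp only [map_sub, K.act_mul _ _ (_ - _), K.act_mul _ _ (_ + _), K.act_mul _ _ (_ * _),
    K.act_mul _ 2, K.act_mul _ (K.metric _ _), K.act_two, a4, ak, aK, map_add,
    h.act_self_metric_bracket hξ, hξ.act_self_metric X Y, ← hξ.metric_bracket_self_self]
  linear_combination 2 * h1

theorem const_mul_eq_zero (X Y : L) :
    (2 * m - c - 2 * μ) * (K.metric X Y - K.metric X ξ * K.metric Y ξ) = 0 := by
  apply K.two_mul_cancel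
  have h1 := K.lieForm_lieForm_metric ξ (K.bracket V ξ) X Y
  rw [h.lieForm_self_lieForm_bracket hξ, hξ.lieForm_lieForm_self] at h1
  simp only [h.act_bracket_metric hξ, h.bracket_self_bracket hξ] at h1
  have e : K.lieForm ((-2 : A) • K.bracket V ξ - (2 * m - c - 2 * μ) • ξ)
      (fun P Q ↦ K.metric P Q) X Y = -2 * K.lieForm (K.bracket V ξ) (fun P Q ↦ K.metric P Q) X Y
      - (2 * m - c - 2 * μ) * K.lieForm ξ (fun P Q ↦ K.metric P Q) X Y := by
    have hb (Z : L) : K.bracket ((-2 : A) • K.bracket V ξ - (2 * m - c - 2 * μ) • ξ) Z =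
        (-2 : A) • K.bracket (K.bracket V ξ) Z - (2 * m - c - 2 * μ) • K.bracket ξ Z := by
      rw [K.bracket_swap, K.bracket_sub, K.bracket_smul, K.bracket_smul, h.act_const,
        map_neg, K.act_two, K.bracket_swap Z, K.bracket_swap Z]
      module
    simp only [lieForm, hb, map_sub, map_smul, AddMonoidHom.sub_apply, K.act_smul_left,
      LinearMap.sub_apply, LinearMap.smul_apply, smul_eq_mul]
    ring
  rw [e] at h1
  have e2 : K.lieForm ξ (fun P Q ↦ K.metric P Q) X Y =
      2 * (K.metric X Y - K.metric X ξ * K.metric Y ξ) := by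
    rw [lieForm, hξ.act_self_metric X Y]
    ring
  rw [e2] at h1
  linear_combination h1

theorem lieCurv_eq_zero (X : L) : K.lieCurv V X ξ ξ = 0 := by
  have e : K.lieCurv V X ξ ξ = (2 * m - c - 2 * μ) • (K.metric X ξ • ξ - X) := by
    have h1 := h.act_metric_self hξ X
    have h2 := h.two_mul_metric_bracket hξ
    simp only [lieCurv, hξ.curv_self_right, hξ.curv_apply_self, hξ.metric_self, K.bracket_sub,
      K.bracket_smul, K.act_one]
    rw [h1, ← neg_eq_iff_eq_neg.mpr h2]
    module
  rw [e]
  refine K.ext_metric _ _ fun Z ↦ ?_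
  have h1 := h.const_mul_eq_zero hξ X Z
  simp only [map_sub, map_smul, map_zero, LinearMap.sub_apply, LinearMap.smul_apply,
    LinearMap.zero_apply, smul_eq_mul]
  rw [K.metric_symm ξ Z]
  linear_combination -h1

end IsEtaSoliton

end MetricLieRinehart

/-- Elements `e i` of a module and linear forms `θ i` on it that are dual bases after
multiplication by a cutoff `χ`: global objects restricting to a local frame and its coframe on the
set where `χ = 1`. -/
structure CutoffFrame (A L ι : Type*) [CommRing A] [AddCommGroup L] [Module A L] [Fintype ι]
    [DecidableEq ι] where
  χ : A
  e : ι → L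
  θ : ι → L →ₗ[A] A
  sum_smul : ∀ W, ∑ i, θ i W • e i = χ • W
  θ_e : ∀ i j, θ i (e j) = if i = j then χ else 0

namespace CutoffFrame

variable {A L ι κ : Type*} [CommRing A] [AddCommGroup L] [Module A L] [Fintype ι]
  [DecidableEq ι] [Fintype κ] [DecidableEq κ]

/-- The trace of an endomorphism in a frame. -/
def trace (F : CutoffFrame A L ι) (T : L →ₗ[A] L) : A := ∑ i, F.θ i (T (F.e i))

theorem χ_mul_apply (F : CutoffFrame A L ι) (f : L →ₗ[A] A) (W : L) :
    F.χ * f W = ∑ i, F.θ i W * f (F.e i) := by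
  rw [← smul_eq_mul, ← map_smul, ← F.sum_smul, map_sum]
  simp

/-- Traces do not depend on the frame. -/
theorem χ_mul_trace (F : CutoffFrame A L ι) (F' : CutoffFrame A L κ) (T : L →ₗ[A] L) :
    F'.χ * F.trace T = F.χ * F'.trace T := by
  simp only [trace, Finset.mul_sum, F.χ_mul_apply (F'.θ _)]
  rw [Finset.sum_comm]
  refine Finset.sum_congr rfl fun i _ ↦ ?_
  rw [← LinearMap.comp_apply, F'.χ_mul_apply (F.θ i ∘ₗ T)]
  exact Finset.sum_congr rfl fun j _ ↦ by rw [mul_comm, LinearMap.comp_apply]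

theorem trace_id (F : CutoffFrame A L ι) : F.trace LinearMap.id = Fintype.card ι * F.χ := by
  simp [trace, F.θ_e]

theorem trace_smulRight (F : CutoffFrame A L ι) (f : L →ₗ[A] A) (X : L) :
    F.trace (f.smulRight X) = F.χ * f X := by
  rw [F.χ_mul_apply]
  simp [trace, mul_comm]

/-- The derivative of a trace is the trace of the Lie derivative. -/
theorem act_trace (F : CutoffFrame A L ι) (K : MetricLieRinehart A L) (X : L) (T T' : L →ₗ[A] L)
    (hT : ∀ W, T' W = K.bracket X (T W) - T (K.bracket X W)) :
    F.χ * F.trace T' + K.act X F.χ * F.trace T = F.χ * K.act X (F.trace T) := by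
  have h1 (i : ι) : F.χ * F.θ i (K.bracket X (T (F.e i))) + K.act X F.χ * F.θ i (T (F.e i)) =
      (∑ j, F.θ j (T (F.e i)) * F.θ i (K.bracket X (F.e j)))
        + F.χ * K.act X (F.θ i (T (F.e i))) := by
    have h := congrArg (fun v ↦ F.θ i (K.bracket X v)) (F.sum_smul (T (F.e i)))
    simp only [K.bracket_sum, K.bracket_smul, map_sum, map_add, map_smul, smul_eq_mul,
      Finset.sum_add_distrib, F.θ_e] at h
    rw [← h]
    simp [mul_comm]
  have h2 (i : ι) : F.χ * F.θ i (T (K.bracket X (F.e i))) =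
      ∑ j, F.θ j (K.bracket X (F.e i)) * F.θ i (T (F.e j)) :=
    F.χ_mul_apply (F.θ i ∘ₗ T) _
  have h3 : F.χ * F.trace T' = ∑ i, F.χ * F.θ i (K.bracket X (T (F.e i)))
      - ∑ i, F.χ * F.θ i (T (K.bracket X (F.e i))) := by
    simp [trace, hT, Finset.mul_sum, mul_sub]
  have h4 : ∑ i, ∑ j, F.θ j (T (F.e i)) * F.θ i (K.bracket X (F.e j)) =
      ∑ i, ∑ j, F.θ j (K.bracket X (F.e i)) * F.θ i (T (F.e j)) := by
    rw [Finset.sum_comm]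
    simp only [mul_comm]
  have h5 := Finset.sum_congr rfl fun i (_ : i ∈ Finset.univ) ↦ h1 i
  simp only [Finset.sum_add_distrib, h4, ← h2, ← Finset.mul_sum, ← map_sum] at h5
  rw [h3]
  simp only [← Finset.mul_sum, trace]
  linear_combination h5

end CutoffFrame

namespace MetricLieRinehart

variable {A L ι : Type*} [CommRing A] [AddCommGroup L] [Module A L] [Fintype ι] [DecidableEq ι]
  (K : MetricLieRinehart A L)

/-- The endomorphism `W ↦ R(W,Y)Z`. -/
def curvEnd (Y Z : L) : L →ₗ[A] L where
  toFun W := K.curv W Y Z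
  map_add' W W' := K.curv_add_left W W' Y Z
  map_smul' f W := K.curv_smul_left f W Y Z

@[simp]
theorem curvEnd_apply (Y Z W : L) : K.curvEnd Y Z W = K.curv W Y Z := rfl

namespace IsKenmotsuField

variable {K} {ξ : L}

theorem trace_curvEnd_self (hξ : K.IsKenmotsuField ξ) (F : CutoffFrame A L ι) (Y : L) :
    F.trace (K.curvEnd Y ξ) = F.χ * -((Fintype.card ι - 1) * K.metric Y ξ) := by
  have h : F.trace (K.curvEnd Y ξ) = F.trace ((K.metric ξ).smulRight Y)
      - K.metric Y ξ * F.trace LinearMap.id := by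
    simp only [CutoffFrame.trace, curvEnd_apply, hξ.curv_apply_self, map_sub, map_smul,
      Finset.sum_sub_distrib, Finset.mul_sum, LinearMap.smulRight_apply, LinearMap.id_apply,
      smul_eq_mul, K.metric_symm ξ]
  rw [h, F.trace_smulRight, F.trace_id, K.metric_symm ξ]
  ring

/-- The Lie derivative of the Ricci tensor along `ξ`, computed in a frame. -/
theorem act_trace_curvEnd (hξ : K.IsKenmotsuField ξ) (F : CutoffFrame A L ι) (Y Z : L) :
    F.χ * (K.act ξ (F.trace (K.curvEnd Y Z)) - F.trace (K.curvEnd (K.bracket ξ Y) Z)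
        - F.trace (K.curvEnd Y (K.bracket ξ Z))) =
      K.act ξ F.χ * F.trace (K.curvEnd Y Z)
        - F.χ * F.χ * (2 * (Fintype.card ι - 1)
          * (K.metric Y Z - K.metric Y ξ * K.metric Z ξ)) := by
  have h := F.act_trace K ξ (K.curvEnd Y Z)
    ((2 : A) • (K.metric Z).smulRight Y - (2 * K.metric Z ξ) • (K.metric ξ).smulRight Y
      - (2 * (K.metric Y Z - K.metric Y ξ * K.metric Z ξ)) • LinearMap.id
      + K.curvEnd (K.bracket ξ Y) Z + K.curvEnd Y (K.bracket ξ Z)) fun W ↦ by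
    have h := hξ.lieCurv_self W Y Z
    simp only [lieCurv] at h
    simp only [LinearMap.add_apply, LinearMap.sub_apply, LinearMap.smul_apply,
      LinearMap.smulRight_apply, LinearMap.id_apply, curvEnd_apply]
    rw [K.metric_symm Z W, K.metric_symm ξ W]
    linear_combination (norm := module) -h
  have hadd (T T' : L →ₗ[A] L) : F.trace (T + T') = F.trace T + F.trace T' := by
    simp [CutoffFrame.trace, Finset.sum_add_distrib]
  have hsub (T T' : L →ₗ[A] L) : F.trace (T - T') = F.trace T - F.trace T' := by
    simp [CutoffFrame.trace]
  have hsmul (f : A) (T : L →ₗ[A] L) : F.trace (f • T) = f * F.trace T := by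
    simp [CutoffFrame.trace, Finset.mul_sum]
  simp only [hadd, hsub, hsmul, F.trace_smulRight, F.trace_id] at h
  rw [K.metric_symm Z Y, K.metric_symm ξ Y] at h
  linear_combination -h

end IsKenmotsuField

end MetricLieRinehart

noncomputable section

namespace RiemannianGeometry

theorem contMDiffAt_det {ι : Type*} [Fintype ι] [DecidableEq ι]
    {E : Type*} [NormedAddCommGroup E] [NormedSpace ℝ E] {H : Type*} [TopologicalSpace H]
    {I : ModelWithCorners ℝ E H} {M : Type*} [TopologicalSpace M] [ChartedSpace H M]
    {G : M → Matrix ι ι ℝ} {x : M}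
    (hG : ∀ i j, CMDiffAt ∞ (fun y ↦ G y i j) x) : CMDiffAt ∞ (fun y ↦ (G y).det) x := by
  simp only [Matrix.det_apply, Units.smul_def, zsmul_eq_mul]
  exact contMDiffAt_finsetSum fun σ _ ↦
    contMDiffAt_const.mul (contMDiffAt_finsetProd fun i _ ↦ hG _ _)

variable {E : Type*} [NormedAddCommGroup E] [NormedSpace ℝ E]
  {H : Type*} [TopologicalSpace H] {I : ModelWithCorners ℝ E H}
  {M : Type*} [TopologicalSpace M] [ChartedSpace H M] [IsManifold I ∞ M]

theorem IsSmoothVF.mdiffAt {X : Π x : M, TangentSpace I x} (hX : IsSmoothVF X) {x : M} :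
    MDiffAt (T% X) x :=
  (hX x).mdifferentiableAt (by simp)

theorem contMDiffAt_inner (g : SmoothMetric I M) {X Y : Π x : M, TangentSpace I x} {x : M}
    (hX : CMDiffAt ∞ (T% X) x) (hY : CMDiffAt ∞ (T% Y) x) :
    CMDiffAt ∞ (fun y ↦ g.inner y (X y) (Y y)) x := by
  have h : ContMDiffAt I (I.prod 𝓘(ℝ)) ∞
      (fun y ↦ TotalSpace.mk' ℝ (E := Bundle.Trivial M ℝ) y (g.inner y (X y) (Y y))) x :=
    ContMDiffAt.clm_bundle_apply₂ (b := fun y : M ↦ y) (F₁ := E) (F₂ := E)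
      (g.contMDiff x) hX hY
  simp only [contMDiffAt_totalSpace] at h
  exact h.2

theorem contMDiff_mvfderiv {f : M → ℝ} {X : Π x : M, TangentSpace I x}
    (hf : CMDiff ∞ f) (hX : IsSmoothVF X) :
    CMDiff ∞ (fun y ↦ mvfderiv I f y (X y)) := by
  intro x
  have h := (hf.contMDiff_tangentMap (m := ∞) (by simp)).contMDiffAt.comp x (hX x)
  rw [contMDiffAt_totalSpace] at h
  simpa using! h.2

theorem isManifold_infty_add_one : IsManifold I (((⊤ : ℕ∞) : WithTop ℕ∞) + 1) M :=
  inferInstanceAs (IsManifold I ∞ M)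

theorem isManifold_minSmoothness_three : IsManifold I (minSmoothness ℝ 3) M := by
  rw [minSmoothness_of_isRCLikeNormedField]
  infer_instance

theorem isManifold_minSmoothness_two : IsManifold I (minSmoothness ℝ 2) M := by
  rw [minSmoothness_of_isRCLikeNormedField]
  infer_instance

theorem IsSmoothVF.mlieBracket [CompleteSpace E] {X Y : Π x : M, TangentSpace I x}
    (hX : IsSmoothVF X) (hY : IsSmoothVF Y) : IsSmoothVF (mlieBracket I X Y) := by
  have : IsManifold I (((⊤ : ℕ∞) : WithTop ℕ∞) + 1) M := isManifold_infty_add_one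
  have : IsManifold I (minSmoothness ℝ 2) M := isManifold_minSmoothness_two
  exact fun x ↦ ContMDiffAt.mlieBracket_vectorField (m := ⊤) (n := ⊤) (hX x) (hY x)
    (by simp [minSmoothness_of_isRCLikeNormedField])

theorem IsSmoothVF.jacobi [CompleteSpace E] {X Y Z : Π x : M, TangentSpace I x}
    (hX : IsSmoothVF X) (hY : IsSmoothVF Y) (hZ : IsSmoothVF Z) (x : M) :
    VectorField.mlieBracket I X (VectorField.mlieBracket I Y Z) x =
      VectorField.mlieBracket I (VectorField.mlieBracket I X Y) Z x
        + VectorField.mlieBracket I Y (VectorField.mlieBracket I X Z) x := by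
  have : IsManifold I (minSmoothness ℝ 3) M := isManifold_minSmoothness_three
  have h2 : minSmoothness ℝ 2 ≤ (∞ : WithTop ℕ∞) := by
    rw [minSmoothness_of_isRCLikeNormedField]
    exact ENat.LEInfty.out
  exact leibniz_identity_mlieBracket_apply ((hX x).of_le h2) ((hY x).of_le h2) ((hZ x).of_le h2)

theorem IsSmoothVF.smul {f : M → ℝ} {X : Π x : M, TangentSpace I x} (hf : CMDiff ∞ f)
    (hX : IsSmoothVF X) : IsSmoothVF (f • X) :=
  ContMDiff.smul_section hf hX

/-- `[X,Y] f = X (Y f) - Y (X f)`, evaluated where some smooth vector field does not vanish. -/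
theorem mvfderiv_mlieBracket_of_ne_zero [CompleteSpace E] {X Y Z : Π x : M, TangentSpace I x}
    {f : M → ℝ} (hX : IsSmoothVF X) (hY : IsSmoothVF Y) (hZ : IsSmoothVF Z) (hf : CMDiff ∞ f)
    {x : M} (hx : Z x ≠ 0) :
    mvfderiv I f x (mlieBracket I X Y x) =
      mvfderiv I (fun y ↦ mvfderiv I f y (Y y)) x (X x)
        - mvfderiv I (fun y ↦ mvfderiv I f y (X y)) x (Y x) := by
  have hfd (y : M) : MDiffAt f y := (hf y).mdifferentiableAt (by simp)
  have e (P Q : Π x : M, TangentSpace I x) (hQ : IsSmoothVF Q) :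
      mlieBracket I P (f • Q) = f • mlieBracket I P Q + (fun y ↦ mvfderiv I f y (P y)) • Q := by
    funext y
    rw [mlieBracket_smul_right (hfd y) hQ.mdiffAt]
    simp [add_comm]
  have hd {P Q : Π x : M, TangentSpace I x} (hP : IsSmoothVF P) (hQ : IsSmoothVF Q) :
      IsSmoothVF ((fun y ↦ mvfderiv I f y (P y)) • Q) :=
    hQ.smul (contMDiff_mvfderiv hf hP)
  have hdf {P : Π x : M, TangentSpace I x} (hP : IsSmoothVF P) :
      MDiffAt (fun y ↦ mvfderiv I f y (P y)) x :=
    (contMDiff_mvfderiv hf hP x).mdifferentiableAt (by simp)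
  have h := hX.jacobi hY (hZ.smul hf) x
  have h' := hX.jacobi hY hZ x
  rw [e Y Z hZ, e X Z hZ, mlieBracket_add_right ((hY.mlieBracket hZ).smul hf).mdiffAt
    (hd hY hZ).mdiffAt, mlieBracket_add_right ((hX.mlieBracket hZ).smul hf).mdiffAt
    (hd hX hZ).mdiffAt, e _ _ (hY.mlieBracket hZ), e _ _ (hX.mlieBracket hZ), e _ _ hZ,
    mlieBracket_smul_right (hdf hX) hZ.mdiffAt, mlieBracket_smul_right (hdf hY) hZ.mdiffAt] at h
  simp only [Pi.add_apply, Pi.smul_apply', h', smul_add] at h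
  have h3 : (mvfderiv I (fun y ↦ mvfderiv I f y (Y y)) x (X x)
        - mvfderiv I (fun y ↦ mvfderiv I f y (X y)) x (Y x)
        - mvfderiv I f x (mlieBracket I X Y x)) • Z x = 0 := by
    linear_combination (norm := module) h
  have := (smul_eq_zero.mp h3).resolve_right hx
  linarith

variable [FiniteDimensional ℝ E]

theorem contMDiff_koszul (g : SmoothMetric I M) {X Y Z : Π x : M, TangentSpace I x}
    (hX : IsSmoothVF X) (hY : IsSmoothVF Y) (hZ : IsSmoothVF Z) :
    CMDiff ∞ (koszul g X Y Z) := by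
  have hi {P Q : Π x : M, TangentSpace I x} (hP : IsSmoothVF P) (hQ : IsSmoothVF Q) :
      CMDiff ∞ (fun y ↦ g.inner y (P y) (Q y)) := fun y ↦ contMDiffAt_inner g (hP y) (hQ y)
  exact ((((contMDiff_mvfderiv (hi hY hZ) hX).add (contMDiff_mvfderiv (hi hZ hX) hY)).sub
    (contMDiff_mvfderiv (hi hX hY) hZ)).sub (hi hX (hY.mlieBracket hZ))).add
    (hi hY (hZ.mlieBracket hX)) |>.add (hi hZ (hX.mlieBracket hY))

/-- A vector field whose inner products with a smooth local frame are smooth is smooth. -/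
theorem contMDiffAt_of_inner (g : SmoothMetric I M) {ι : Type*} [Fintype ι]
    {s : ι → Π x : M, TangentSpace I x} {u : Set M} {x : M} (hs : IsLocalFrameOn I E ∞ s u)
    (hu : u ∈ nhds x) {v : Π x : M, TangentSpace I x}
    (hv : ∀ i, CMDiffAt ∞ (fun y ↦ g.inner y (v y) (s i y)) x) : CMDiffAt ∞ (T% v) x := by
  classical
  let G (y : M) : Matrix ι ι ℝ := Matrix.of fun i j ↦ g.inner y (s i y) (s j y)
  have hsx (i : ι) : CMDiffAt ∞ (T% (s i)) x := (hs.contMDiffOn i).contMDiffAt hu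
  have hG (i j : ι) : CMDiffAt ∞ (fun y ↦ G y i j) x := contMDiffAt_inner g (hsx i) (hsx j)
  have hdet {y : M} (hy : y ∈ u) : (G y).det ≠ 0 := by
    intro h0
    obtain ⟨a, ha, h⟩ := Matrix.exists_mulVec_eq_zero_iff.mpr h0
    have h1 : g.inner y (∑ i, a i • s i y) (∑ j, a j • s j y) = 0 := by
      have : ∀ i, g.inner y (s i y) (∑ j, a j • s j y) = 0 := fun i ↦ by
        have := congrFun h i
        simp only [Matrix.mulVec, dotProduct, G, Matrix.of_apply, Pi.zero_apply] at this
        simpa [mul_comm] using this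
      have aux (w : TangentSpace I y) (hw : ∀ i, g.inner y (s i y) w = 0) :
          g.inner y (∑ i, a i • s i y) w = 0 := by simp [hw]
      exact aux _ this
    have h2 : ∑ i, a i • s i y = 0 := by
      by_contra hne
      exact (g.pos y _ hne).ne' h1
    exact ha (funext fun i ↦ Fintype.linearIndependent_iff.mp (hs.linearIndependent hy) a h2 i)
  have key {y : M} (hy : y ∈ u) (i : ι) : hs.coeff i y (v y) =
      (G y).det⁻¹ * ∑ j, (G y).adjugate i j * g.inner y (v y) (s j y) := by
    have h1 (j : ι) : g.inner y (v y) (s j y) = ((G y).mulVec fun k ↦ hs.coeff k y (v y)) j := by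
      conv_lhs => rw [hs.coeff_sum_eq v hy]
      simp only [map_sum, map_smul, FunLike.coe_sum, Finset.sum_apply, FunLike.coe_smul,
        Pi.smul_apply, smul_eq_mul, Matrix.mulVec, dotProduct, G, Matrix.of_apply]
      exact Finset.sum_congr rfl fun k _ ↦ by rw [g.symm, mul_comm]
    have h2 : ∑ j, (G y).adjugate i j * g.inner y (v y) (s j y) =
        (G y).det * hs.coeff i y (v y) := by
      simp only [h1]
      change ((G y).adjugate.mulVec _) i = _
      rw [Matrix.mulVec_mulVec, Matrix.adjugate_mul, Matrix.smul_mulVec, Matrix.one_mulVec]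
      rfl
    rw [h2, inv_mul_cancel_left₀ (hdet hy)]
  refine hs.contMDiffAt_of_coeff (fun i ↦ ?_) hu
  have hadj (j : ι) : CMDiffAt ∞ (fun y ↦ (G y).adjugate i j) x := by
    simp only [Matrix.adjugate_apply]
    refine contMDiffAt_det fun k l ↦ ?_
    by_cases hk : k = j
    · subst hk
      simpa using contMDiffAt_const
    · simpa [Matrix.updateRow_apply, hk] using hG k l
  refine ContMDiffAt.congr_of_eventuallyEq (f := fun y ↦
    (G y).det⁻¹ * ∑ j, (G y).adjugate i j * g.inner y (v y) (s j y)) ?_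
    (Filter.eventually_of_mem hu fun y hy ↦ key hy i)
  exact ((contMDiffAt_det hG).inv₀ (hdet (mem_of_mem_nhds hu))).mul
    (contMDiffAt_finsetSum fun j _ ↦ (hadj j).mul (hv j))

end RiemannianGeometry

end

noncomputable section

namespace RiemannianGeometry

variable {E : Type*} [NormedAddCommGroup E] [NormedSpace ℝ E]
  {H : Type*} [TopologicalSpace H] {I : ModelWithCorners ℝ E H}
  {M : Type*} [TopologicalSpace M] [ChartedSpace H M] [IsManifold I ∞ M]

variable (I M) in
/-- The smooth vector fields on `M`. -/
abbrev SmoothVF := ContMDiffSection I E ∞ (TangentSpace I : M → Type _)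

theorem SmoothVF.isSmoothVF (X : SmoothVF I M) : IsSmoothVF (X : Π x : M, TangentSpace I x) :=
  X.contMDiff

instance : SMul C^∞⟮I, M; ℝ⟯ (SmoothVF I M) where
  smul f X := ⟨fun x ↦ f x • X x, X.isSmoothVF.smul f.contMDiff⟩

theorem SmoothVF.smul_apply (f : C^∞⟮I, M; ℝ⟯) (X : SmoothVF I M) (x : M) :
    (f • X) x = f x • X x := rfl

instance : Module C^∞⟮I, M; ℝ⟯ (SmoothVF I M) where
  one_smul X := by ext x; exact one_smul ℝ (X x)
  mul_smul f h X := by ext x; exact mul_smul (f x) (h x) (X x)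
  smul_zero f := by ext x; exact smul_zero (f x)
  smul_add f X Y := by ext x; exact smul_add (f x) (X x) (Y x)
  add_smul f h X := by ext x; exact add_smul (f x) (h x) (X x)
  zero_smul X := by ext x; exact zero_smul ℝ (X x)

theorem SmoothVF.sum_apply {ι : Type*} (s : Finset ι) (X : ι → SmoothVF I M) (x : M) :
    (∑ i ∈ s, X i) x = ∑ i ∈ s, X i x := by
  rw [← ContMDiffSection.coeAddHom_apply, map_sum, Finset.sum_apply]
  rfl

variable [FiniteDimensional ℝ E] [T2Space M]

/-- A frame of global vector fields extending a basis of one tangent space. -/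
theorem exists_cutoffFrame {ι : Type*} [Fintype ι] [DecidableEq ι] {x : M}
    (b : Module.Basis ι ℝ (TangentSpace I x)) :
    ∃ F : CutoffFrame C^∞⟮I, M; ℝ⟯ (SmoothVF I M) ι,
      (∀ᶠ y in nhds x, F.χ y = 1) ∧
      (∀ i, ∀ᶠ y in nhds x, F.e i y = FiberBundle.extend E (b i) y) ∧
      (∀ i W, F.θ i W x = b.repr (W x) i) ∧
      ∃ u ∈ nhds x, IsLocalFrameOn I E ∞ (fun i y ↦ F.e i y) u := by
  let t := trivializationAt E (TangentSpace I : M → Type _) x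
  have hx : x ∈ t.baseSet := FiberBundle.mem_baseSet_trivializationAt' x
  let B : Module.Basis ι ℝ E := b.map (t.linearEquivAt ℝ x hx)
  obtain ⟨f, hf, -⟩ := (SmoothBumpFunction.nhds_basis_support (I := I)
    (t.open_baseSet.mem_nhds hx)).mem_iff.mp (t.open_baseSet.mem_nhds hx)
  have h0 {y : M} (hy : y ∉ t.baseSet) : f y = 0 := image_eq_zero_of_notMem_tsupport
    fun h ↦ hy (hf h)
  let e (i : ι) : SmoothVF I M := ⟨(⇑f : M → ℝ) • t.localFrame B i,
    ContMDiffOn.smul_section_of_tsupport f.contMDiff.contMDiffOn t.open_baseSet hf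
      (t.contMDiffOn_localFrame_baseSet ∞ B i)⟩
  have hsm (i : ι) (W : SmoothVF I M) :
      CMDiff ∞ (fun y ↦ f y * t.localFrameCoeff I B i y (W y)) := by
    refine contMDiff_of_tsupport fun y hy ↦ ?_
    have hy' : y ∈ t.baseSet := hf (closure_mono (Function.support_mul_subset_left _ _) hy)
    exact f.contMDiffAt.mul (contMDiffAt_localFrameCoeff B hy' (W.isSmoothVF y) i)
  let θ (i : ι) : SmoothVF I M →ₗ[C^∞⟮I, M; ℝ⟯] C^∞⟮I, M; ℝ⟯ :=
    { toFun W := ⟨_, hsm i W⟩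
      map_add' W W' := by
        ext y
        change f y * t.localFrameCoeff I B i y (W y + W' y) =
          f y * t.localFrameCoeff I B i y (W y) + f y * t.localFrameCoeff I B i y (W' y)
        rw [map_add, mul_add]
      map_smul' h W := by
        ext y
        change f y * t.localFrameCoeff I B i y (h y • W y) =
          h y * (f y * t.localFrameCoeff I B i y (W y))
        rw [map_smul, smul_eq_mul]
        ring }
  let χ : C^∞⟮I, M; ℝ⟯ := ⟨fun y ↦ f y * f y, f.contMDiff.mul f.contMDiff⟩
  let F : CutoffFrame C^∞⟮I, M; ℝ⟯ (SmoothVF I M) ι :=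
    { χ := χ
      e := e
      θ := θ
      sum_smul W := by
        ext y
        rw [SmoothVF.sum_apply]
        change ∑ i, (f y * t.localFrameCoeff I B i y (W y)) • f y • t.localFrame B i y =
          (f y * f y) • W y
        by_cases hy : y ∈ t.baseSet
        · conv_rhs => rw [t.eq_sum_localFrameCoeff_smul (I := I) (b := B) (s := W) hy, Finset.smul_sum]
          exact Finset.sum_congr rfl fun i _ ↦ by module
        · simp only [h0 hy, zero_mul, zero_smul, Finset.sum_const_zero]
      θ_e i j := by
        ext y
        have h2 : (if i = j then χ else 0) y = f y * (f y * if i = j then 1 else 0) := by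
          split_ifs
          · exact (by ring : f y * f y = f y * (f y * 1))
          · exact (by ring : (0 : ℝ) = f y * (f y * 0))
        rw [h2]
        change f y * t.localFrameCoeff I B i y (f y • t.localFrame B j y) = _
        by_cases hy : y ∈ t.baseSet
        · rw [map_smul, t.localFrameCoeff_apply_of_mem_baseSet B hy,
            t.localFrame_apply_of_mem_baseSet B hy]
          simp [Finsupp.single_apply, eq_comm]
        · simp [h0 hy] }
  have hfe : ∀ᶠ y in nhds x, f y = 1 := f.eventuallyEq_one
  have hbase : ∀ᶠ y in nhds x, y ∈ t.baseSet := t.open_baseSet.mem_nhds hx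
  refine ⟨F, hfe.mono fun y hy ↦ ?_, fun i ↦ ?_, fun i W ↦ ?_, ?_⟩
  · change f y * f y = 1
    simp [hy]
  · filter_upwards [hfe, hbase] with y hy hy'
    change f y • t.localFrame B i y = _
    rw [hy, one_smul, t.localFrame_apply_of_mem_baseSet B hy']
    rfl
  · change f x * t.localFrameCoeff I B i x (W x) = _
    rw [f.eq_one, one_mul, t.localFrameCoeff_apply_of_mem_baseSet B hx]
    simp [Bundle.Trivialization.basisAt, B, hx]
  · refine ⟨{y | f y = 1} ∩ t.baseSet, Filter.inter_mem hfe hbase, ?_⟩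
    refine ((t.isLocalFrameOn_localFrame_baseSet I ∞ B).mono Set.inter_subset_right).congr
      fun i y hy ↦ ?_
    change _ = f y • t.localFrame B i y
    rw [hy.1, one_smul]

theorem IsSmoothVF.nabla (g : SmoothMetric I M) {X Y : Π x : M, TangentSpace I x}
    (hX : IsSmoothVF X) (hY : IsSmoothVF Y) : IsSmoothVF (nabla g X Y) := by
  intro x
  obtain ⟨F, -, -, -, u, hu, hF⟩ := exists_cutoffFrame (I := I) (x := x)
    (Module.finBasis ℝ E)
  refine contMDiffAt_of_inner g hF hu fun i ↦ ?_
  have h (y : M) : g.inner y (RiemannianGeometry.nabla g X Y y) (F.e i y)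
      = (1 / 2) * koszul g X Y (F.e i) y := by
    rw [← two_mul_inner_nabla g hX.mdiffAt hY.mdiffAt (F.e i).isSmoothVF.mdiffAt]
    ring
  simp only [h]
  exact contMDiffAt_const.mul (contMDiff_koszul g hX hY (F.e i).isSmoothVF x)

end RiemannianGeometry

end

noncomputable section

namespace RiemannianGeometry

variable {E : Type*} [NormedAddCommGroup E] [NormedSpace ℝ E]
  {H : Type*} [TopologicalSpace H] {I : ModelWithCorners ℝ E H}
  {M : Type*} [TopologicalSpace M] [ChartedSpace H M] [IsManifold I ∞ M]

theorem mvfderiv_mlieBracket [CompleteSpace E] {X Y : Π x : M, TangentSpace I x}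
    {f : M → ℝ} (hX : IsSmoothVF X) (hY : IsSmoothVF Y) (hf : CMDiff ∞ f) (x : M) :
    mvfderiv I f x (mlieBracket I X Y x) =
      mvfderiv I (fun y ↦ mvfderiv I f y (Y y)) x (X x)
        - mvfderiv I (fun y ↦ mvfderiv I f y (X y)) x (Y x) := by
  by_cases h1 : X x = 0
  · by_cases h2 : Y x = 0
    · rw [← mlieBracketWithin_univ, mlieBracketWithin_eq_zero_of_eq_zero h1 h2, h1, h2]
      simp
    · exact mvfderiv_mlieBracket_of_ne_zero hX hY hY hf h2
  · exact mvfderiv_mlieBracket_of_ne_zero hX hY hX hf h1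

/-- The derivative of a smooth function along a smooth vector field. -/
def SmoothVF.actHom : SmoothVF I M →+ C^∞⟮I, M; ℝ⟯ →+ C^∞⟮I, M; ℝ⟯ :=
  AddMonoidHom.mk' (fun X ↦ AddMonoidHom.mk'
    (fun f ↦ ⟨fun y ↦ mvfderiv I f y (X y), contMDiff_mvfderiv f.contMDiff X.isSmoothVF⟩)
    fun f h ↦ by
      ext y
      change mvfderiv I (fun y ↦ f y + h y) y (X y) =
        mvfderiv I f y (X y) + mvfderiv I h y (X y)
      rw [mvfderiv_fun_add f.mdifferentiableAt h.mdifferentiableAt]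
      rfl)
    fun X Y ↦ by
      ext f y
      exact map_add (mvfderiv I f y) (X y) (Y y)

theorem SmoothVF.actHom_apply (X : SmoothVF I M) (f : C^∞⟮I, M; ℝ⟯) (y : M) :
    SmoothVF.actHom X f y = mvfderiv I f y (X y) := rfl

theorem SmoothVF.actHom_apply_congr {f h : C^∞⟮I, M; ℝ⟯} (X : SmoothVF I M) {x : M}
    (hfh : ∀ᶠ y in nhds x, f y = h y) : SmoothVF.actHom X f x = SmoothVF.actHom X h x := by
  have e : mfderiv I 𝓘(ℝ, ℝ) f x = mfderiv I 𝓘(ℝ, ℝ) h x := Filter.EventuallyEq.mfderiv_eq hfh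
  exact DFunLike.congr_fun e (X x)

/-- The inner product of smooth vector fields. -/
def SmoothVF.innerHom (g : SmoothMetric I M) :
    SmoothVF I M →ₗ[C^∞⟮I, M; ℝ⟯] SmoothVF I M →ₗ[C^∞⟮I, M; ℝ⟯] C^∞⟮I, M; ℝ⟯ :=
  LinearMap.mk₂ _ (fun X Y ↦ ⟨fun y ↦ g.inner y (X y) (Y y),
      fun y ↦ contMDiffAt_inner g (X.isSmoothVF y) (Y.isSmoothVF y)⟩)
    (fun X X' Y ↦ by
      ext y
      change g.inner y (X y + X' y) (Y y) = g.inner y (X y) (Y y) + g.inner y (X' y) (Y y)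
      simp)
    (fun f X Y ↦ by
      ext y
      change g.inner y (f y • X y) (Y y) = f y * g.inner y (X y) (Y y)
      simp)
    (fun X Y Y' ↦ by
      ext y
      change g.inner y (X y) (Y y + Y' y) = g.inner y (X y) (Y y) + g.inner y (X y) (Y' y)
      simp)
    (fun f X Y ↦ by
      ext y
      change g.inner y (X y) (f y • Y y) = f y * g.inner y (X y) (Y y)
      simp)

variable [FiniteDimensional ℝ E] [T2Space M]

/-- The covariant derivative of smooth vector fields. -/
def SmoothVF.nablaHom (g : SmoothMetric I M) : SmoothVF I M →+ SmoothVF I M →+ SmoothVF I M :=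
  AddMonoidHom.mk' (fun X ↦ AddMonoidHom.mk'
    (fun Y ↦ ⟨nabla g X Y, X.isSmoothVF.nabla g Y.isSmoothVF⟩)
    fun Y Y' ↦ by
      ext y
      exact congrArg (fun T : TangentSpace I y →L[ℝ] TangentSpace I y ↦ T (X y))
        ((leviCivita g).isCovariantDerivativeOnUniv.add Y.isSmoothVF.mdiffAt
          Y'.isSmoothVF.mdiffAt trivial))
    fun X X' ↦ by
      ext Y y
      exact map_add (leviCivita g Y y) (X y) (X' y)

theorem SmoothVF.nablaHom_sub (g : SmoothMetric I M) (X Y : SmoothVF I M) :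
    ⇑(SmoothVF.nablaHom g X Y - SmoothVF.nablaHom g Y X) = mlieBracket I X Y :=
  funext fun _ ↦ nabla_sub_nabla g X.isSmoothVF.mdiffAt Y.isSmoothVF.mdiffAt

/-- The smooth vector fields on a Riemannian manifold, as a Lie–Rinehart algebra over the smooth
functions with the metric and the Levi-Civita connection. -/
def metricLieRinehart (g : SmoothMetric I M) :
    MetricLieRinehart C^∞⟮I, M; ℝ⟯ (SmoothVF I M) where
  act := SmoothVF.actHom
  conn := SmoothVF.nablaHom g
  metric := SmoothVF.innerHom g
  act_mul X f h := by
    ext y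
    change mvfderiv I (fun y ↦ f y * h y) y (X y) =
      mvfderiv I f y (X y) * h y + f y * mvfderiv I h y (X y)
    rw [mvfderiv_fun_mul f.mdifferentiableAt h.mdifferentiableAt]
    simp
    ring
  act_smul_left f X h := by
    ext y
    exact map_smul (mvfderiv I h y) (f y) (X y)
  conn_smul_left f X Y := by
    ext y
    exact map_smul (leviCivita g Y y) (f y) (X y)
  conn_smul X f Y := by
    ext y
    have h := congrArg (fun T : TangentSpace I y →L[ℝ] TangentSpace I y ↦ T (X y))
        ((leviCivita g).isCovariantDerivativeOnUniv.leibniz Y.isSmoothVF.mdiffAt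
          f.mdifferentiableAt trivial)
    simpa using! h
  act_bracket X Y f := by
    ext y
    rw [SmoothVF.actHom_apply, SmoothVF.nablaHom_sub]
    exact mvfderiv_mlieBracket X.isSmoothVF Y.isSmoothVF f.contMDiff y
  jacobi X Y Z := by
    ext y
    rw [ContMDiffSection.coe_add]
    simp only [SmoothVF.nablaHom_sub]
    exact X.isSmoothVF.jacobi Y.isSmoothVF Z.isSmoothVF y
  metric_symm X Y := by
    ext y
    exact g.symm y _ _
  act_metric X Y Z := by
    ext y
    exact mvfderiv_inner g X.isSmoothVF.mdiffAt Y.isSmoothVF.mdiffAt Z.isSmoothVF.mdiffAt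
  ext_metric X Y h := by
    rw [← sub_eq_zero]
    ext y
    have h1 : SmoothVF.innerHom g (X - Y) (X - Y) = 0 := by
      rw [LinearMap.map_sub₂, h, sub_self]
    by_contra hne
    exact (g.pos y _ hne).ne' (DFunLike.congr_fun h1 y)
  two_mul_cancel f hf := by
    rw [two_mul] at hf
    ext y
    have h1 : f y + f y = 0 := DFunLike.congr_fun hf y
    change f y = 0
    linarith

theorem coe_bracket (g : SmoothMetric I M) (X Y : SmoothVF I M) :
    ⇑((metricLieRinehart g).bracket X Y) = mlieBracket I X Y :=
  SmoothVF.nablaHom_sub g X Y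

theorem coe_curv (g : SmoothMetric I M) (X Y Z : SmoothVF I M) :
    ⇑((metricLieRinehart g).curv X Y Z) = curvature g X Y Z := by
  rw [curvature, ← coe_bracket g]
  rfl

theorem coe_lieCurv (g : SmoothMetric I M) (V X Y Z : SmoothVF I M) :
    ⇑((metricLieRinehart g).lieCurv V X Y Z) = lieCurvature g V X Y Z := by
  simp only [MetricLieRinehart.lieCurv, lieCurvature, ContMDiffSection.coe_sub, coe_bracket,
    coe_curv]

theorem lieForm_metric_apply (g : SmoothMetric I M) (V X Y : SmoothVF I M) (x : M) :
    (metricLieRinehart g).lieForm V (fun P Q ↦ (metricLieRinehart g).metric P Q) X Y x =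
      lieMetric g V X Y x := by
  rw [lieMetric, ← coe_bracket g, ← coe_bracket g]
  rfl

theorem curvature_congr_left (g : SmoothMetric I M) {W W' Y Z : Π x : M, TangentSpace I x} {x : M}
    (hW : IsSmoothVF W) (hZ : IsSmoothVF Z) (h : ∀ᶠ y in nhds x, W y = W' y) :
    curvature g W Y Z x = curvature g W' Y Z x := by
  have h1 : ∀ᶠ y in nhds x, nabla g W Z y = nabla g W' Z y := h.mono fun y hy ↦ by
    simp only [nabla, hy]
  have hd : MDiffAt (T% (nabla g W Z)) x := (hW.nabla g hZ).mdiffAt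
  have hd' : MDiffAt (T% (nabla g W' Z)) x :=
    hd.congr_of_eventuallyEq (h1.mono fun y hy ↦ by simp only [hy])
  have h2 : leviCivita g (nabla g W Z) x = leviCivita g (nabla g W' Z) x :=
    (leviCivita g).isCovariantDerivativeOnUniv.congr_of_eventuallyEq hd hd' Filter.univ_mem h1
  have h3 : mlieBracket I W Y x = mlieBracket I W' Y x :=
    Filter.EventuallyEq.mlieBracket_vectorField_eq h Filter.EventuallyEq.rfl
  simp only [curvature, Pi.sub_apply]
  have e1 : nabla g W (nabla g Y Z) x = nabla g W' (nabla g Y Z) x := by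
    simp only [nabla, h.self_of_nhds]
  have e2 : nabla g Y (nabla g W Z) x = nabla g Y (nabla g W' Z) x :=
    congrArg (fun T : TangentSpace I x →L[ℝ] TangentSpace I x ↦ T (Y x)) h2
  have e3 : nabla g (mlieBracket I W Y) Z x = nabla g (mlieBracket I W' Y) Z x :=
    congrArg (leviCivita g Z x) h3
  rw [e1, e2, e3]

/-- The Ricci tensor is a trace in any frame. -/
theorem ricci_eq_trace (g : SmoothMetric I M) {ι : Type*} [Fintype ι] [DecidableEq ι]
    (F : CutoffFrame C^∞⟮I, M; ℝ⟯ (SmoothVF I M) ι) (Y Z : SmoothVF I M) {x : M}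
    (hx : F.χ x = 1) :
    ricci g Y Z x = F.trace ((metricLieRinehart g).curvEnd Y Z) x := by
  let b : Module.Basis (Fin (Module.finrank ℝ E)) ℝ (TangentSpace I x) := Module.finBasis ℝ E
  obtain ⟨F', hχ, he, hθ, -⟩ := exists_cutoffFrame b
  have h : F'.χ x * F.trace ((metricLieRinehart g).curvEnd Y Z) x =
      F.χ x * F'.trace ((metricLieRinehart g).curvEnd Y Z) x :=
    DFunLike.congr_fun (F.χ_mul_trace F' ((metricLieRinehart g).curvEnd Y Z)) x
  rw [hx, hχ.self_of_nhds, one_mul, one_mul] at h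
  rw [h, CutoffFrame.trace]
  refine Eq.trans ?_ (map_sum (ContMDiffMap.evalRingHom x) _ _).symm
  refine Finset.sum_congr rfl fun i _ ↦ ?_
  change _ = F'.θ i (((metricLieRinehart g).curvEnd Y Z) (F'.e i)) x
  rw [hθ, MetricLieRinehart.curvEnd_apply, coe_curv,
    curvature_congr_left g (F'.e i).isSmoothVF Z.isSmoothVF (he i)]

end RiemannianGeometry

end

noncomputable section

namespace RiemannianGeometry

variable {E : Type*} [NormedAddCommGroup E] [NormedSpace ℝ E] [FiniteDimensional ℝ E]
  {H : Type*} [TopologicalSpace H] {I : ModelWithCorners ℝ E H}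
  {M : Type*} [TopologicalSpace M] [ChartedSpace H M] [IsManifold I ∞ M] [T2Space M]

/-- In a Kenmotsu manifold, `∇_X ξ = X - η(X) ξ`. -/
theorem AlmostContactMetricStructure.IsKenmotsu.isKenmotsuField {g : SmoothMetric I M}
    {A : AlmostContactMetricStructure g} (hA : A.IsKenmotsu) :
    (metricLieRinehart g).IsKenmotsuField (⟨A.ξ, A.contMDiff_ξ⟩ : SmoothVF I M) where
  metric_self := by
    ext x
    exact (A.η_eq x _).symm.trans (A.η_ξ x)
  conn_self X := by
    ext x
    have hφξ (y : M) : A.φ y (A.ξ y) = 0 := by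
      by_contra hne
      refine (g.pos y _ hne).ne' ?_
      rw [A.inner_φ_φ, ← A.η_eq, A.η_ξ]
      ring
    have hηφ (v : TangentSpace I x) : A.η x (A.φ x v) = 0 := by
      have h1 := A.φ_φ x (A.φ x v)
      rw [A.φ_φ x v, map_add, map_neg, map_smul, hφξ, smul_zero, add_zero, left_eq_add] at h1
      have h2 := congrArg (A.η x) h1
      simpa [A.η_ξ] using h2
    have h0 : nabla g X (fun y ↦ A.φ y (A.ξ y)) x = 0 := by
      have : (fun y ↦ A.φ y (A.ξ y)) = 0 := funext hφξ
      rw [this, nabla, (leviCivita g).zero]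
      rfl
    have h1 := hA X A.ξ X.isSmoothVF A.contMDiff_ξ x
    rw [h0, ← A.η_eq, hηφ, A.η_ξ, zero_smul, zero_sub, zero_sub, one_smul, neg_inj] at h1
    have h2 : A.η x (nabla g X A.ξ x) = 0 := by
      have h := mvfderiv_inner g (X.isSmoothVF.mdiffAt (x := x)) A.contMDiff_ξ.mdiffAt
        A.contMDiff_ξ.mdiffAt
      have hc : (fun y ↦ g.inner y (A.ξ y) (A.ξ y)) = fun _ ↦ (1 : ℝ) :=
        funext fun y ↦ by rw [← A.η_eq, A.η_ξ]
      rw [hc, mvfderiv_const, g.symm x (A.ξ x), ← A.η_eq] at h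
      have h' : (0 : ℝ) = A.η x (nabla g X A.ξ x) + A.η x (nabla g X A.ξ x) := h
      linarith
    have h3 := congrArg (A.φ x) h1
    rw [A.φ_φ, A.φ_φ, h2, zero_smul, add_zero, A.η_eq x (X x)] at h3
    change nabla g X A.ξ x = X x - g.inner x (X x) (A.ξ x) • A.ξ x
    linear_combination (norm := module) -h3

theorem contMDiff_ricci (g : SmoothMetric I M) (Y Z : SmoothVF I M) : CMDiff ∞ (ricci g Y Z) := by
  intro x
  obtain ⟨F, hχ, -⟩ := exists_cutoffFrame (I := I) (x := x) (Module.finBasis ℝ E)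
  exact (F.trace ((metricLieRinehart g).curvEnd Y Z)).contMDiff.contMDiffAt.congr_of_eventuallyEq
    (hχ.mono fun y hy ↦ ricci_eq_trace g F Y Z hy)

/-- The Ricci tensor as a smooth function of a pair of smooth vector fields. -/
def ricciMap (g : SmoothMetric I M) (Y Z : SmoothVF I M) : C^∞⟮I, M; ℝ⟯ :=
  ⟨ricci g Y Z, contMDiff_ricci g Y Z⟩

variable {g : SmoothMetric I M} {ξ : SmoothVF I M} {m : ℕ}

theorem ricciMap_self (hξ : (metricLieRinehart g).IsKenmotsuField ξ)
    (hm : Module.finrank ℝ E = m + 1) (X : SmoothVF I M) :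
    ricciMap g X ξ = -(m * (metricLieRinehart g).metric X ξ) := by
  ext x
  obtain ⟨F, hχ, -⟩ := exists_cutoffFrame (I := I) (x := x) (Module.finBasis ℝ E)
  have h := hξ.trace_curvEnd_self F X
  have hc : ((Module.finrank ℝ E : ℕ) : C^∞⟮I, M; ℝ⟯) - 1 = m := by
    rw [hm, Nat.cast_succ, add_sub_cancel_right]
  rw [Fintype.card_fin, hc] at h
  have h1 := congrArg (ContMDiffMap.evalRingHom x) h
  rw [map_mul] at h1
  have h2 : ContMDiffMap.evalRingHom x F.χ = 1 := hχ.self_of_nhds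
  rw [h2, one_mul] at h1
  exact (ricci_eq_trace g F X ξ hχ.self_of_nhds).trans h1

theorem lieForm_ricciMap (hξ : (metricLieRinehart g).IsKenmotsuField ξ)
    (hm : Module.finrank ℝ E = m + 1) (X Y : SmoothVF I M) :
    (metricLieRinehart g).lieForm ξ (ricciMap g) X Y =
      -(2 * m * ((metricLieRinehart g).metric X Y
        - (metricLieRinehart g).metric X ξ * (metricLieRinehart g).metric Y ξ)) := by
  ext x
  obtain ⟨F, hχ, -⟩ := exists_cutoffFrame (I := I) (x := x) (Module.finBasis ℝ E)
  have h := congrArg (ContMDiffMap.evalRingHom x) (hξ.act_trace_curvEnd F X Y)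
  have hc : ((Module.finrank ℝ E : ℕ) : C^∞⟮I, M; ℝ⟯) - 1 = m := by
    rw [hm, Nat.cast_succ, add_sub_cancel_right]
  rw [Fintype.card_fin, hc, map_sub, map_mul, map_mul, map_mul, map_mul] at h
  have h2 : ContMDiffMap.evalRingHom x F.χ = 1 := hχ.self_of_nhds
  have h3 : ContMDiffMap.evalRingHom x ((metricLieRinehart g).act ξ F.χ) = 0 := by
    have e : SmoothVF.actHom ξ F.χ x = SmoothVF.actHom ξ 1 x := SmoothVF.actHom_apply_congr ξ hχ
    refine e.trans ?_
    rw [show SmoothVF.actHom ξ 1 = 0 from (metricLieRinehart g).act_one ξ]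
    rfl
  rw [h2, h3, zero_mul, one_mul, one_mul, one_mul, zero_sub, ← map_neg] at h
  refine Eq.trans ?_ h
  have hr (P Q : SmoothVF I M) : ricciMap g P Q x =
      F.trace ((metricLieRinehart g).curvEnd P Q) x := ricci_eq_trace g F P Q hχ.self_of_nhds
  have ha : SmoothVF.actHom ξ (ricciMap g X Y) x =
      SmoothVF.actHom ξ (F.trace ((metricLieRinehart g).curvEnd X Y)) x :=
    SmoothVF.actHom_apply_congr ξ (hχ.mono fun y hy ↦ ricci_eq_trace g F X Y hy)
  change SmoothVF.actHom ξ (ricciMap g X Y) x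
      - ricciMap g ((metricLieRinehart g).bracket ξ X) Y x
      - ricciMap g X ((metricLieRinehart g).bracket ξ Y) x = _
  rw [ha, hr, hr]
  rfl

theorem AlmostContactMetricStructure.IsConformalEtaRicciSoliton.isEtaSoliton
    {A : AlmostContactMetricStructure g} {V : Π x : M, TangentSpace I x} {lam mu p : ℝ}
    (hV : A.IsConformalEtaRicciSoliton V lam mu p) (hA : A.IsKenmotsu)
    (hm : Module.finrank ℝ E = m + 1) :
    (metricLieRinehart g).IsEtaSoliton (⟨A.ξ, A.contMDiff_ξ⟩ : SmoothVF I M) ⟨V, hV.smooth⟩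
      (ricciMap g) m
      (algebraMap ℝ C^∞⟮I, M; ℝ⟯ (2 * lam - (p + 2 / (Module.finrank ℝ E : ℝ))))
      (algebraMap ℝ C^∞⟮I, M; ℝ⟯ mu) where
  act_c X := by
    ext x
    exact DFunLike.congr_fun (mvfderiv_const (I := I) _) (X x)
  act_μ X := by
    ext x
    exact DFunLike.congr_fun (mvfderiv_const (I := I) _) (X x)
  apply_self := ricciMap_self hA.isKenmotsuField hm
  lieForm_self := lieForm_ricciMap hA.isKenmotsuField hm
  soliton X Y := by
    ext x
    have h := hV.eq_zero X Y X.isSmoothVF Y.isSmoothVF x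
    let ev : C^∞⟮I, M; ℝ⟯ →+* ℝ := ContMDiffMap.evalRingHom x
    have h2 : ev 2 = 2 := map_ofNat ev 2
    rw [A.η_eq, A.η_eq] at h
    refine Eq.trans ?_ h
    refine (map_add ev _ _).trans ?_
    rw [map_add, map_add, map_mul, map_mul, map_mul, map_mul, map_mul, h2]
    exact congrArg (fun r : ℝ ↦ r + 2 * ricci g X Y x
      + (2 * lam - (p + 2 / (Module.finrank ℝ E : ℝ))) * g.inner x (X x) (Y x)
      + 2 * mu * (g.inner x (X x) (A.ξ x) * g.inner x (Y x) (A.ξ x)))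
      (lieForm_metric_apply g ⟨V, hV.smooth⟩ X Y x)

end RiemannianGeometry

end

theorem lie_derivative_curvature_xi_xi_eq_zero_of_conformal_eta_ricci_soliton
    {E : Type*} [NormedAddCommGroup E] [NormedSpace ℝ E] [FiniteDimensional ℝ E]
    {H : Type*} [TopologicalSpace H] {I : ModelWithCorners ℝ E H} [I.Boundaryless]
    {M : Type*} [TopologicalSpace M] [T2Space M] [ChartedSpace H M] [IsManifold I ∞ M]
    (n : ℕ) (hn : Module.finrank ℝ E = 2 * n + 1)
    (g : RiemannianGeometry.SmoothMetric I M) (A : RiemannianGeometry.AlmostContactMetricStructure g) (hA : A.IsKenmotsu)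
    (V : Π x : M, TangentSpace I x) (lam mu p : ℝ)
    (hV : A.IsConformalEtaRicciSoliton V lam mu p)
    (X : Π x : M, TangentSpace I x) (hX : RiemannianGeometry.IsSmoothVF X) (x : M) :
    RiemannianGeometry.lieCurvature g V X A.ξ A.ξ x = 0 := by
  have h := (hV.isEtaSoliton hA hn).lieCurv_eq_zero hA.isKenmotsuField ⟨X, hX⟩
  have h1 := RiemannianGeometry.coe_lieCurv g (⟨V, hV.smooth⟩ : RiemannianGeometry.SmoothVF I M)
    ⟨X, hX⟩ ⟨A.ξ, A.contMDiff_ξ⟩ ⟨A.ξ, A.contMDiff_ξ⟩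
  rw [h] at h1
  exact (congrFun h1 x).symm
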